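/- arXiv:1301.1707 — 3 statements merged into one kernel-verified Lean document; each statement's English description precedes it below -/
import Mathlib

section
/- Let c > 30 be a real number and n a positive integer with n > 2c/π + 5·log(c)·log(c/2) (natural logarithms). Then all the quadrature weights are positive: W_j > 0 for every j = 1, …, n. -/
open Real MeasureTheory Set

/-- A `k`-th prolate datum for band limit `c`: `ψ` is real-analytic with unit
`L²[-1,1]` norm, has exactly `k` zeros in `(-1,1)`, is an eigenfunction of the
prolate integral operator with nonzero eigenvalue `lam`, and satisfies the
prolate differential equation with eigenvalue `χ`. -/
structure ProlateDatum (c : ℝ) (k : ℕ) (ψ : ℝ → ℝ) (lam : ℂ) (χ : ℝ) : Prop where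
  analytic : ∀ x : ℝ, AnalyticAt ℝ ψ x
  normalized : ∫ t in (-1:ℝ)..1, (ψ t)^2 = 1
  zeros_card : {x : ℝ | x ∈ Set.Ioo (-1:ℝ) 1 ∧ ψ x = 0}.encard = k
  lam_ne_zero : lam ≠ 0
  integral_eig : ∀ x : ℝ,
    lam * (ψ x : ℂ) =
      ∫ t in (-1:ℝ)..1, (ψ t : ℂ) * Complex.exp (Complex.I * (c:ℂ) * (x:ℂ) * (t:ℂ))
  diff_eq : ∀ x : ℝ,
    (1 - x^2) * deriv (deriv ψ) x - 2*x * deriv ψ x + (χ - c^2 * x^2) * ψ x = 0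

/-- The `j`-th weight of the PSWF-based quadrature rule:
`W_j = (1/ψₙ'(t_j)) ∫_{-1}^1 ψₙ(s)/(s - t_j) ds`. -/
noncomputable def quadWeight (ψn : ℝ → ℝ) (tj : ℝ) : ℝ :=
  (1 / deriv ψn tj) * ∫ s in (-1:ℝ)..1, ψn s / (s - tj)


lemma param_deriv (F F' : ℝ → ℝ → ℝ) (hF : Continuous (Function.uncurry F))
    (hF' : Continuous (Function.uncurry F'))
    (h : ∀ x s, HasDerivAt (fun y => F y s) (F' x s) x) (a b x : ℝ) :
    HasDerivAt (fun y => ∫ s in a..b, F y s) (∫ s in a..b, F' x s) x := by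
  obtain ⟨C, hC⟩ := ((isCompact_closedBall x 1).prod (isCompact_uIcc (a := a) (b := b))).exists_bound_of_continuousOn
    hF'.continuousOn
  have hc : ∀ y, Continuous (fun s => F y s) := fun y => hF.comp (by fun_prop : Continuous fun s => (y, s))
  have hc' : ∀ y, Continuous (fun s => F' y s) := fun y => hF'.comp (by fun_prop : Continuous fun s => (y, s))
  refine (intervalIntegral.hasDerivAt_integral_of_dominated_loc_of_deriv_le (bound := fun _ => C)
    (Metric.closedBall_mem_nhds x one_pos) ?_ ?_ ?_ ?_ ?_ ?_).2
  · exact Filter.Eventually.of_forall fun y => (hc y).aestronglyMeasurable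
  · exact (hc x).intervalIntegrable _ _
  · exact (hc' x).aestronglyMeasurable
  · exact Filter.Eventually.of_forall fun s hs y hy => hC (y, s) ⟨hy, uIoc_subset_uIcc hs⟩
  · exact intervalIntegrable_const
  · exact Filter.Eventually.of_forall fun s hs y hy => h y s

lemma param_cont (F : ℝ → ℝ → ℝ → ℝ) (hF : Continuous (fun p : ℝ × ℝ × ℝ => F p.1 p.2.1 p.2.2)) (a b : ℝ) :
    Continuous (Function.uncurry fun x s => ∫ r in a..b, F x s r) := by
  apply intervalIntegral.continuous_parametric_intervalIntegral_of_continuous' (f := fun p : ℝ × ℝ => F p.1 p.2)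
  exact hF.comp (by fun_prop : Continuous fun p : (ℝ × ℝ) × ℝ => (p.1.1, p.1.2, p.2))

lemma weight_identity (c χ : ℝ) (f f1 f2 f3 : ℝ → ℝ)
    (h1 : ∀ x, HasDerivAt f (f1 x) x) (h2 : ∀ x, HasDerivAt f1 (f2 x) x)
    (h3 : ∀ x, HasDerivAt f2 (f3 x) x) (hc3 : Continuous f3)
    (hode : ∀ x, (1 - x^2) * f2 x - 2 * x * f1 x + (χ - c^2 * x^2) * f x = 0)
    (t : ℝ) (hft : f t = 0) :
    (1 - t^2) * (f1 t * ∫ s in (-1:ℝ)..1, f s / (s - t)) =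
      2 * f 1 ^ 2 + ∫ x in t..1, c^2 * (f x * ((∫ s in (-1:ℝ)..1, s * f s) + x * ∫ s in (-1:ℝ)..1, f s)) := by
  have hc0 : Continuous f := continuous_iff_continuousAt.2 fun x => (h1 x).continuousAt
  have hc1 : Continuous f1 := continuous_iff_continuousAt.2 fun x => (h2 x).continuousAt
  have hc2 : Continuous f2 := continuous_iff_continuousAt.2 fun x => (h3 x).continuousAt
  set D : ℝ → ℝ → ℝ := fun x s => ∫ r in (0:ℝ)..1, f1 (x + r * (s - x)) with hD
  set Dx : ℝ → ℝ → ℝ := fun x s => ∫ r in (0:ℝ)..1, (1 - r) * f2 (x + r * (s - x)) with hDx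
  set Ds : ℝ → ℝ → ℝ := fun x s => ∫ r in (0:ℝ)..1, r * f2 (x + r * (s - x)) with hDs
  set Dxx : ℝ → ℝ → ℝ := fun x s => ∫ r in (0:ℝ)..1, (1 - r) * ((1 - r) * f3 (x + r * (s - x))) with hDxx
  set Dxs : ℝ → ℝ → ℝ := fun x s => ∫ r in (0:ℝ)..1, (1 - r) * (r * f3 (x + r * (s - x))) with hDxs
  set Dss : ℝ → ℝ → ℝ := fun x s => ∫ r in (0:ℝ)..1, r * (r * f3 (x + r * (s - x))) with hDss
  have cD : Continuous (Function.uncurry D) := param_cont _ (by fun_prop) 0 1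
  have cDx : Continuous (Function.uncurry Dx) := param_cont _ (by fun_prop) 0 1
  have cDs : Continuous (Function.uncurry Ds) := param_cont _ (by fun_prop) 0 1
  have cDxx : Continuous (Function.uncurry Dxx) := param_cont _ (by fun_prop) 0 1
  have cDxs : Continuous (Function.uncurry Dxs) := param_cont _ (by fun_prop) 0 1
  have cDss : Continuous (Function.uncurry Dss) := param_cont _ (by fun_prop) 0 1
  have inx : ∀ (s r x : ℝ), HasDerivAt (fun y => y + r * (s - y)) (1 - r) x := by
    intro s r x
    have := (hasDerivAt_id x).add (((hasDerivAt_const x s).sub (hasDerivAt_id x)).const_mul r)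
    exact this.congr_deriv (by ring)
  have ins : ∀ (x r s : ℝ), HasDerivAt (fun y => x + r * (y - x)) r s := by
    intro x r s
    have := ((hasDerivAt_id s).sub_const x).const_mul r |>.const_add x
    exact this.congr_deriv (by ring)
  have dDx : ∀ x s, HasDerivAt (fun y => D y s) (Dx x s) x := by
    intro x s
    refine param_deriv (fun y r => f1 (y + r * (s - y))) (fun y r => (1 - r) * f2 (y + r * (s - y)))
      (by unfold Function.uncurry; fun_prop) (by unfold Function.uncurry; fun_prop) ?_ 0 1 x
    intro y r
    have := (h2 _).comp y (inx s r y)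
    exact this.congr_deriv (by ring)
  have dDs : ∀ x s, HasDerivAt (fun y => D x y) (Ds x s) s := by
    intro x s
    refine param_deriv (fun y r => f1 (x + r * (y - x))) (fun y r => r * f2 (x + r * (y - x)))
      (by unfold Function.uncurry; fun_prop) (by unfold Function.uncurry; fun_prop) ?_ 0 1 s
    intro y r
    have := (h2 _).comp y (ins x r y)
    exact this.congr_deriv (by ring)
  have dDxx : ∀ x s, HasDerivAt (fun y => Dx y s) (Dxx x s) x := by
    intro x s
    refine param_deriv (fun y r => (1 - r) * f2 (y + r * (s - y))) (fun y r => (1 - r) * ((1 - r) * f3 (y + r * (s - y))))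
      (by unfold Function.uncurry; fun_prop) (by unfold Function.uncurry; fun_prop) ?_ 0 1 x
    intro y r
    have := ((h3 _).comp y (inx s r y)).const_mul (1 - r)
    exact this.congr_deriv (by ring)
  have dDxs : ∀ x s, HasDerivAt (fun y => Dx x y) (Dxs x s) s := by
    intro x s
    refine param_deriv (fun y r => (1 - r) * f2 (x + r * (y - x))) (fun y r => (1 - r) * (r * f3 (x + r * (y - x))))
      (by unfold Function.uncurry; fun_prop) (by unfold Function.uncurry; fun_prop) ?_ 0 1 s
    intro y r
    have := ((h3 _).comp y (ins x r y)).const_mul (1 - r)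
    exact this.congr_deriv (by ring)
  have dDss : ∀ x s, HasDerivAt (fun y => Ds x y) (Dss x s) s := by
    intro x s
    refine param_deriv (fun y r => r * f2 (x + r * (y - x))) (fun y r => r * (r * f3 (x + r * (y - x))))
      (by unfold Function.uncurry; fun_prop) (by unfold Function.uncurry; fun_prop) ?_ 0 1 s
    intro y r
    have := ((h3 _).comp y (ins x r y)).const_mul r
    exact this.congr_deriv (by ring)
  have e0 : ∀ x s, (s - x) * D x s = f s - f x := by
    intro x s
    have hder : ∀ r : ℝ, HasDerivAt (fun r => f (x + r * (s - x))) ((s - x) * f1 (x + r * (s - x))) r := by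
      intro r
      have hi : HasDerivAt (fun r : ℝ => x + r * (s - x)) (s - x) r := by
        have := ((hasDerivAt_id r).mul_const (s - x)).const_add x
        exact this.congr_deriv (by ring)
      have := (h1 _).comp r hi
      exact this.congr_deriv (by ring)
    have := intervalIntegral.integral_eq_sub_of_hasDerivAt (a := 0) (b := 1) (fun r _ => hder r)
      (Continuous.intervalIntegrable (by fun_prop) _ _)
    rw [intervalIntegral.integral_const_mul] at this
    rw [hD]; simp only; rw [this]; congr 1 <;> congr 1 <;> ring
  have sx : ∀ s x : ℝ, HasDerivAt (fun y => s - y) (-1) x := fun s x => by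
    simpa using (hasDerivAt_id x).const_sub s
  have ss : ∀ x s : ℝ, HasDerivAt (fun y => y - x) 1 s := fun x s => by
    simpa using (hasDerivAt_id s).sub_const x
  have e1 : ∀ x s, (s - x) * Dx x s = D x s - f1 x := by
    intro x s
    have ha := (sx s x).mul (dDx x s)
    have hb : HasDerivAt (fun y => (s - y) * D y s) (- f1 x) x := by
      have := (h1 x).const_sub (f s)
      exact this.congr_of_eventuallyEq (Filter.Eventually.of_forall fun y => e0 y s)
    have := ha.unique hb
    linarith
  have e2 : ∀ x s, (s - x) * Ds x s = f1 s - D x s := by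
    intro x s
    have ha := (ss x s).mul (dDs x s)
    have hb : HasDerivAt (fun y => (y - x) * D x y) (f1 s) s := by
      have := (h1 s).sub_const (f x)
      exact this.congr_of_eventuallyEq (Filter.Eventually.of_forall fun y => e0 x y)
    have := ha.unique hb
    linarith
  have e3 : ∀ x s, (s - x) * Dxx x s = 2 * Dx x s - f2 x := by
    intro x s
    have ha := (sx s x).mul (dDxx x s)
    have hb : HasDerivAt (fun y => (s - y) * Dx y s) (Dx x s - f2 x) x := by
      have := (dDx x s).sub (h2 x)
      exact this.congr_of_eventuallyEq (Filter.Eventually.of_forall fun y => e1 y s)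
    have := ha.unique hb
    linarith
  have e4 : ∀ x s, (s - x) * Dxs x s = Ds x s - Dx x s := by
    intro x s
    have ha := (ss x s).mul (dDxs x s)
    have hb : HasDerivAt (fun y => (y - x) * Dx x y) (Ds x s) s := by
      have := (dDs x s).sub_const (f1 x)
      exact this.congr_of_eventuallyEq (Filter.Eventually.of_forall fun y => e1 x y)
    have := ha.unique hb
    linarith
  have e5 : ∀ x s, (s - x) * Dss x s = f2 s - 2 * Ds x s := by
    intro x s
    have ha := (ss x s).mul (dDss x s)
    have hb : HasDerivAt (fun y => (y - x) * Ds x y) (f2 s - Ds x s) s := by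
      have := (h2 s).sub (dDs x s)
      exact this.congr_of_eventuallyEq (Filter.Eventually.of_forall fun y => e2 x y)
    have := ha.unique hb
    linarith
  have sl : ∀ {G : ℝ → ℝ → ℝ}, Continuous (Function.uncurry G) → ∀ x, Continuous (G x) := by
    intro G hG x
    exact hG.comp (by fun_prop : Continuous fun s : ℝ => (x, s))
  have key : ∀ x s, (1 - x^2) * Dxx x s - 2 * x * Dx x s + (χ - c^2 * x^2) * D x s =
      c^2 * (s + x) * f s + (2 * s * (Ds x s + 2 * Dx x s) - (1 - s^2) * (Dss x s + 2 * Dxs x s) + 2 * f1 x) := by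
    intro x
    have : (fun s => (1 - x^2) * Dxx x s - 2 * x * Dx x s + (χ - c^2 * x^2) * D x s) =
      fun s => c^2 * (s + x) * f s + (2 * s * (Ds x s + 2 * Dx x s) - (1 - s^2) * (Dss x s + 2 * Dxs x s) + 2 * f1 x) := by
      have a1 := sl cD x
      have a2 := sl cDx x
      have a3 := sl cDs x
      have a4 := sl cDxx x
      have a5 := sl cDxs x
      have a6 := sl cDss x
      refine Continuous.ext_on (dense_compl_singleton x) (by fun_prop) (by fun_prop) ?_
      intro s hs
      beta_reduce
      have hs' : s - x ≠ 0 := sub_ne_zero.2 hs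
      apply mul_left_cancel₀ hs'
      apply mul_left_cancel₀ hs'
      have E0 := e0 x s
      have E1 := e1 x s
      have E2 := e2 x s
      have E3 := e3 x s
      have E4 := e4 x s
      have E5 := e5 x s
      have O1 := hode x
      have O2 := hode s
      linear_combination (1 - x^2) * ((s - x) * E3 + 2 * E1) - 2 * x * (s - x) * E1
        + (χ - c^2 * x^2) * (s - x) * E0 - 2 * s * ((s - x) * E2 + 2 * (s - x) * E1)
        + (1 - s^2) * ((s - x) * E5 - 2 * E2 + 2 * ((s - x) * E4 + E2 - E1))
        - (s - x) * O1 + (s - x) * O2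
    exact fun s => congrFun this s
  set K : ℝ → ℝ := fun x => ∫ s in (-1:ℝ)..1, D x s with hK
  set K1 : ℝ → ℝ := fun x => ∫ s in (-1:ℝ)..1, Dx x s with hK1
  set K2 : ℝ → ℝ := fun x => ∫ s in (-1:ℝ)..1, Dxx x s with hK2
  set I0 : ℝ := ∫ s in (-1:ℝ)..1, f s with hI0
  set I1 : ℝ := ∫ s in (-1:ℝ)..1, s * f s with hI1
  have dK : ∀ x, HasDerivAt K (K1 x) x := fun x => param_deriv D Dx cD cDx dDx (-1) 1 x
  have dK1 : ∀ x, HasDerivAt K1 (K2 x) x := fun x => param_deriv Dx Dxx cDx cDxx dDxx (-1) 1 x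
  have keyK : ∀ x, (1 - x^2) * K2 x - 2 * x * K1 x + (χ - c^2 * x^2) * K x =
      c^2 * (I1 + x * I0) + 4 * f1 x := by
    intro x
    have a1 := sl cD x
    have a2 := sl cDx x
    have a3 := sl cDs x
    have a4 := sl cDxx x
    have a5 := sl cDxs x
    have a6 := sl cDss x
    have dB : ∀ s, HasDerivAt (fun s => -((1 - s^2) * (Ds x s + 2 * Dx x s)) + 2 * (s + x) * f1 x)
        (2 * s * (Ds x s + 2 * Dx x s) - (1 - s^2) * (Dss x s + 2 * Dxs x s) + 2 * f1 x) s := by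
      intro s
      have p1 : HasDerivAt (fun s : ℝ => 1 - s^2) (-(2 * s)) s := by
        have := (hasDerivAt_pow 2 s).const_sub 1
        exact this.congr_deriv (by norm_num)
      have p2 := (dDss x s).add ((dDxs x s).const_mul 2)
      have p3 : HasDerivAt (fun s : ℝ => 2 * (s + x) * f1 x) (2 * f1 x) s := by
        have := (((hasDerivAt_id s).add_const x).const_mul 2).mul_const (f1 x)
        exact this.congr_deriv (by ring)
      exact ((p1.mul p2).neg.add p3).congr_deriv (by simp only [Pi.add_apply]; ring)
    have FT := intervalIntegral.integral_eq_sub_of_hasDerivAt (a := -1) (b := 1) (fun s _ => dB s)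
      (Continuous.intervalIntegrable (by fun_prop) _ _)
    have L : (∫ s in (-1:ℝ)..1, ((1 - x^2) * Dxx x s - 2 * x * Dx x s + (χ - c^2 * x^2) * D x s)) =
        (1 - x^2) * K2 x - 2 * x * K1 x + (χ - c^2 * x^2) * K x := by
      rw [intervalIntegral.integral_add, intervalIntegral.integral_sub,
        intervalIntegral.integral_const_mul, intervalIntegral.integral_const_mul,
        intervalIntegral.integral_const_mul]
      all_goals exact Continuous.intervalIntegrable (by fun_prop) _ _
    have R : (∫ s in (-1:ℝ)..1, c^2 * (s + x) * f s) = c^2 * (I1 + x * I0) := by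
      have : ∀ s, c^2 * (s + x) * f s = c^2 * (s * f s + x * f s) := fun s => by ring
      simp_rw [this]
      rw [intervalIntegral.integral_const_mul, intervalIntegral.integral_add,
        intervalIntegral.integral_const_mul]
      all_goals exact Continuous.intervalIntegrable (by fun_prop) _ _
    rw [← L]
    simp_rw [key x]
    rw [intervalIntegral.integral_add, FT, R]
    · ring
    all_goals exact Continuous.intervalIntegrable (by fun_prop) _ _
  have dV : ∀ x, HasDerivAt (fun x => (1 - x^2) * (K1 x * f x - f1 x * K x) - 2 * f x ^ 2)
      (c^2 * (f x * (I1 + x * I0))) x := by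
    intro x
    have p1 : HasDerivAt (fun s : ℝ => 1 - s^2) (-(2 * x)) x := by
      have := (hasDerivAt_pow 2 x).const_sub 1
      exact this.congr_deriv (by norm_num)
    have := (p1.mul (((dK1 x).mul (h1 x)).sub ((h2 x).mul (dK x)))).sub (((h1 x).pow 2).const_mul 2)
    refine this.congr_deriv ?_
    simp only [Pi.sub_apply, Pi.mul_apply]
    have := keyK x
    have := hode x
    linear_combination f x * keyK x - K x * hode x
  have FT := intervalIntegral.integral_eq_sub_of_hasDerivAt (a := t) (b := 1) (fun s _ => dV s)
      (Continuous.intervalIntegrable (by fun_prop) _ _)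
  have hKt : (∫ s in (-1:ℝ)..1, f s / (s - t)) = K t := by
    apply intervalIntegral.integral_congr_ae
    have : ∀ᵐ s : ℝ, s ≠ t := by
      simp [ae_iff]
    filter_upwards [this] with s hs _
    have hs' : s - t ≠ 0 := sub_ne_zero.2 hs
    rw [div_eq_iff hs', mul_comm, e0, hft, sub_zero]
  rw [hKt, FT, hft]
  ring

lemma mono_helper {F F' : ℝ → ℝ} {a b : ℝ} (hd : ∀ x ∈ Icc a b, HasDerivAt F (F' x) x)
    (h0 : ∀ x ∈ Ioo a b, 0 ≤ F' x) {x y : ℝ} (hx : a ≤ x) (hxy : x ≤ y) (hy : y ≤ b) : F x ≤ F y := by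
  have : MonotoneOn F (Icc a b) := by
    apply monotoneOn_of_deriv_nonneg (convex_Icc a b)
    · exact fun z hz => (hd z hz).continuousAt.continuousWithinAt
    · rw [interior_Icc]
      exact fun z hz => (hd z (Ioo_subset_Icc_self hz)).differentiableAt.differentiableWithinAt
    · rw [interior_Icc]
      intro z hz
      rw [(hd z (Ioo_subset_Icc_self hz)).deriv]
      exact h0 z hz
  exact this ⟨hx, hxy.trans hy⟩ ⟨hx.trans hxy, hy⟩ hxy

/-- The prolate equation for a function given with its first two derivatives. -/
structure Prol (c χ : ℝ) (f f1 f2 : ℝ → ℝ) : Prop where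
  d1 : ∀ x, HasDerivAt f (f1 x) x
  d2 : ∀ x, HasDerivAt f1 (f2 x) x
  ode : ∀ x, (1 - x^2) * f2 x - 2 * x * f1 x + (χ - c^2 * x^2) * f x = 0

lemma Prol.c0 {c χ : ℝ} {f f1 f2 : ℝ → ℝ} (h : Prol c χ f f1 f2) : Continuous f :=
  continuous_iff_continuousAt.2 fun x => (h.d1 x).continuousAt

lemma Prol.c1 {c χ : ℝ} {f f1 f2 : ℝ → ℝ} (h : Prol c χ f f1 f2) : Continuous f1 :=
  continuous_iff_continuousAt.2 fun x => (h.d2 x).continuousAt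

lemma hasDerivAt_one_sub_sq (x : ℝ) : HasDerivAt (fun s : ℝ => 1 - s^2) (-(2 * x)) x := by
  have := (hasDerivAt_pow 2 x).const_sub 1
  exact this.congr_deriv (by norm_num)

lemma Prol.dp {c χ : ℝ} {f f1 f2 : ℝ → ℝ} (h : Prol c χ f f1 f2) (x : ℝ) :
    HasDerivAt (fun x => (1 - x^2) * f1 x) (-((χ - c^2 * x^2) * f x)) x := by
  refine ((hasDerivAt_one_sub_sq x).mul (h.d2 x)).congr_deriv ?_
  linear_combination h.ode x

lemma Prol.neg {c χ : ℝ} {f f1 f2 : ℝ → ℝ} (h : Prol c χ f f1 f2) :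
    Prol c χ (fun x => - f x) (fun x => - f1 x) (fun x => - f2 x) :=
  ⟨fun x => (h.d1 x).neg, fun x => (h.d2 x).neg, fun x => by linear_combination - h.ode x⟩

lemma Prol.smul {c χ : ℝ} {f f1 f2 : ℝ → ℝ} (h : Prol c χ f f1 f2) (k : ℝ) :
    Prol c χ (fun x => k * f x) (fun x => k * f1 x) (fun x => k * f2 x) :=
  ⟨fun x => (h.d1 x).const_mul k, fun x => (h.d2 x).const_mul k, fun x => by linear_combination k * h.ode x⟩

lemma Prol.refl' {c χ : ℝ} {f f1 f2 : ℝ → ℝ} (h : Prol c χ f f1 f2) :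
    Prol c χ (fun x => f (-x)) (fun x => - f1 (-x)) (fun x => f2 (-x)) := by
  refine ⟨fun x => ?_, fun x => ?_, fun x => ?_⟩
  · exact ((h.d1 (-x)).comp x (hasDerivAt_neg x)).congr_deriv (by ring)
  · exact ((h.d2 (-x)).comp x (hasDerivAt_neg x)).neg.congr_deriv (by ring)
  · linear_combination h.ode (-x)

/-- ODE uniqueness to the right. -/
lemma Prol.unique {c χ : ℝ} {f f1 f2 : ℝ → ℝ} (h : Prol c χ f f1 f2) {a y : ℝ} (ha : -1 < a)
    (hay : a ≤ y) (hy : y < 1) (h0 : f a = 0) (h1 : f1 a = 0) : f y = 0 := by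
  have hp : ∀ x ∈ Icc a y, 0 < 1 - x^2 := by
    intro x hx
    nlinarith [hx.1, hx.2]
  obtain ⟨A, hA⟩ := (isCompact_Icc (a := a) (b := y)).exists_bound_of_continuousOn
    (f := fun x : ℝ => (2 * x) / (1 - x^2))
    (ContinuousOn.div (by fun_prop) (by fun_prop) fun x hx => (hp x hx).ne')
  obtain ⟨B, hB⟩ := (isCompact_Icc (a := a) (b := y)).exists_bound_of_continuousOn
    (f := fun x : ℝ => (χ - c^2 * x^2) / (1 - x^2))
    (ContinuousOn.div (by fun_prop) (by fun_prop) fun x hx => (hp x hx).ne')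
  set C := 1 + B + 2 * A with hC
  have hd : ∀ x, HasDerivAt (fun x => -(exp (-(C * x)) * (f x ^ 2 + f1 x ^ 2)))
      (exp (-(C * x)) * (C * (f x ^ 2 + f1 x ^ 2) - (2 * f x * f1 x + 2 * f1 x * f2 x))) x := by
    intro x
    have e : HasDerivAt (fun x => exp (-(C * x))) (exp (-(C * x)) * (-C)) x := by
      have := ((hasDerivAt_id x).const_mul C).neg.exp
      exact this.congr_deriv (by simp)
    refine (e.mul (((h.d1 x).pow 2).add ((h.d2 x).pow 2))).neg.congr_deriv ?_
    simp only [Pi.add_apply, Pi.pow_apply]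
    push_cast
    ring
  have := mono_helper (a := a) (b := y) (fun x _ => hd x) ?_ le_rfl hay le_rfl
  · simp only [h0, h1] at this
    have e := exp_pos (-(C * y))
    have : f y ^ 2 + f1 y ^ 2 ≤ 0 := by
      by_contra hcon
      push Not at hcon
      nlinarith [mul_pos e hcon]
    nlinarith [sq_nonneg (f y), sq_nonneg (f1 y), pow_eq_zero_iff (two_ne_zero) (a := f y)]
  · intro x hx
    apply mul_nonneg (exp_pos _).le
    have hx' := Ioo_subset_Icc_self hx
    have p := hp x hx'
    have hA' := hA x hx'
    have hB' := hB x hx'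
    set α := (2 * x) / (1 - x^2) with hα
    set β := (χ - c^2 * x^2) / (1 - x^2) with hβ
    have hf2 : f2 x = α * f1 x - β * f x := by
      have := h.ode x
      rw [hα, hβ]
      field_simp
      linarith
    rw [Real.norm_eq_abs, abs_le] at hA' hB'
    rw [hf2, hC]
    have q1 : -(2 * f x * f1 x) ≤ f x ^2 + f1 x ^ 2 := by nlinarith [sq_nonneg (f x + f1 x)]
    have q2 : (2 * f x * f1 x) ≤ f x ^2 + f1 x ^ 2 := by nlinarith [sq_nonneg (f x - f1 x)]
    have q3 : (2 * f x * f1 x) * (-β) ≤ B * (f x ^2 + f1 x ^ 2) := by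
      have s1 : |2 * f x * f1 x| ≤ f x ^2 + f1 x ^ 2 := abs_le.2 ⟨by linarith, q2⟩
      have s2 : |-β| ≤ B := by rw [abs_neg]; exact abs_le.2 hB'
      calc _ ≤ |(2 * f x * f1 x) * (-β)| := le_abs_self _
        _ = |2 * f x * f1 x| * |-β| := abs_mul _ _
        _ ≤ (f x ^2 + f1 x ^ 2) * B := mul_le_mul s1 s2 (abs_nonneg _) (by positivity)
        _ = _ := by ring
    have hA0 : 0 ≤ A := by linarith
    have q4 : 2 * α * f1 x ^ 2 ≤ 2 * A * (f x ^ 2 + f1 x ^ 2) := by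
      nlinarith [mul_nonneg (sub_nonneg.2 hA'.2) (sq_nonneg (f1 x)), mul_nonneg hA0 (sq_nonneg (f x))]
    nlinarith

noncomputable def phaseG (c δ x : ℝ) : ℝ :=
  c * x + (c * δ / 2 + 1) * (1 / 2 * (Real.log (1 + x) - Real.log (1 - x)))

lemma phaseG_deriv (c δ x : ℝ) (h1 : -1 < x) (h2 : x < 1) :
    HasDerivAt (phaseG c δ) (c + (c * δ / 2 + 1) / (1 - x^2)) x := by
  have a : 0 < 1 + x := by linarith
  have b : 0 < 1 - x := by linarith
  have l1 : HasDerivAt (fun x => Real.log (1 + x)) (1 / (1 + x)) x := ((hasDerivAt_id x).const_add 1).log a.ne'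
  have l2 : HasDerivAt (fun x => Real.log (1 - x)) (-1 / (1 - x)) x := ((hasDerivAt_id x).const_sub 1).log b.ne'
  have := ((hasDerivAt_id x).const_mul c).add (((l1.sub l2).const_mul (1/2)).const_mul (c * δ / 2 + 1))
  refine this.congr_deriv ?_
  have : 1 - x^2 = (1 + x) * (1 - x) := by ring
  rw [this]
  field_simp
  ring

lemma right_deriv_pos {c χ : ℝ} {f f1 f2 : ℝ → ℝ} (h : Prol c χ f f1 f2) {a b : ℝ} (ha : -1 < a)
    (hab : a < b) (hb : b < 1) (h0 : f a = 0) (hpos : ∀ x ∈ Ioo a b, 0 < f x) : 0 < f1 a := by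
  have hne : f1 a ≠ 0 := by
    intro h1
    have := h.unique (y := (a + b) / 2) ha (by linarith) (by linarith) h0 h1
    have := hpos ((a + b) / 2) ⟨by linarith, by linarith⟩
    linarith
  have : 0 ≤ f1 a := by
    have ht := (hasDerivAt_iff_tendsto_slope.1 (h.d1 a)).mono_left
      (nhdsWithin_mono a (show Ioi a ⊆ {a}ᶜ from fun x hx => ne_of_gt hx))
    refine ge_of_tendsto ht ?_
    filter_upwards [Ioo_mem_nhdsGT hab] with x hx
    rw [slope_def_field, h0, sub_zero]
    exact div_nonneg (hpos x hx).le (by linarith [hx.1])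
  exact lt_of_le_of_ne this (Ne.symm hne)

lemma spacing_pos {c δ χ : ℝ} {f f1 f2 : ℝ → ℝ} (h : Prol c χ f f1 f2) (hc : 0 < c) (hδ : 0 < δ)
    (hχ : χ ≤ c^2 * (1 + δ)) {a b : ℝ} (ha : -1 < a)
    (hab : a < b) (hb : b < 1) (h0 : f a = 0) (h1 : f b = 0) (hpos : ∀ x ∈ Ioo a b, 0 < f x) :
    π ≤ phaseG c δ b - phaseG c δ a := by
  have hfa := right_deriv_pos h ha hab hb h0 hpos
  have hfb : f1 b < 0 := by
    have := right_deriv_pos h.refl' (a := -b) (b := -a) (by linarith) (by linarith) (by linarith)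
      (by simpa using h1) (fun x hx => hpos (-x) ⟨by linarith [hx.2], by linarith [hx.1]⟩)
    simpa using this
  set g : ℝ → ℝ := fun x => c * (1 - x^2 + δ / 2) with hg
  have hp : ∀ x ∈ Icc a b, 0 < 1 - x^2 := by
    intro x hx
    nlinarith [hx.1, hx.2]
  have hgp : ∀ x ∈ Icc a b, 0 < g x := fun x hx => mul_pos hc (by linarith [hp x hx])
  set w : ℝ → ℝ := fun x => ((1 - x^2) * f1 x / g x) * (f x)⁻¹ with hw
  have cf := h.c0
  have cf1 := h.c1
  have cN : ∀ x ∈ Icc a b, ContinuousAt (fun x => (1 - x^2) * f1 x / g x) x := by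
    intro x hx
    refine ContinuousAt.div (by fun_prop) (by fun_prop) (hgp x hx).ne'
  have ma : a ∈ Icc a b := ⟨le_rfl, hab.le⟩
  have mb : b ∈ Icc a b := ⟨hab.le, le_rfl⟩
  have ta : Filter.Tendsto w (nhdsWithin a (Ioi a)) Filter.atTop := by
    refine Filter.Tendsto.pos_mul_atTop (C := (1 - a^2) * f1 a / g a) ?_ ((cN a ma).mono_left nhdsWithin_le_nhds) ?_
    · exact div_pos (mul_pos (hp a ma) hfa) (hgp a ma)
    · refine tendsto_inv_nhdsGT_zero.comp (tendsto_nhdsWithin_iff.2 ⟨?_, ?_⟩)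
      · have := cf.continuousAt (x := a)
        rw [ContinuousAt, h0] at this
        exact this.mono_left nhdsWithin_le_nhds
      · filter_upwards [Ioo_mem_nhdsGT hab] with x hx using hpos x hx
  have tb : Filter.Tendsto w (nhdsWithin b (Iio b)) Filter.atBot := by
    refine Filter.Tendsto.neg_mul_atTop (C := (1 - b^2) * f1 b / g b) ?_ ((cN b mb).mono_left nhdsWithin_le_nhds) ?_
    · exact div_neg_of_neg_of_pos (mul_neg_of_pos_of_neg (hp b mb) hfb) (hgp b mb)
    · refine tendsto_inv_nhdsGT_zero.comp (tendsto_nhdsWithin_iff.2 ⟨?_, ?_⟩)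
      · have := cf.continuousAt (x := b)
        rw [ContinuousAt, h1] at this
        exact this.mono_left nhdsWithin_le_nhds
      · filter_upwards [Ioo_mem_nhdsLT hab] with x hx using hpos x hx
  have cG : ∀ x ∈ Icc a b, ContinuousAt (phaseG c δ) x := fun x hx =>
    (phaseG_deriv c δ x (by linarith [hx.1]) (by linarith [hx.2])).continuousAt
  have la : Filter.Tendsto (fun x => arctan (w x) + phaseG c δ x) (nhdsWithin a (Ioi a))
      (nhds (π / 2 + phaseG c δ a)) :=
    ((tendsto_arctan_atTop.mono_right nhdsWithin_le_nhds).comp ta).add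
      ((cG a ma).mono_left nhdsWithin_le_nhds)
  have lb : Filter.Tendsto (fun x => arctan (w x) + phaseG c δ x) (nhdsWithin b (Iio b))
      (nhds (-(π / 2) + phaseG c δ b)) :=
    ((tendsto_arctan_atBot.mono_right nhdsWithin_le_nhds).comp tb).add
      ((cG b mb).mono_left nhdsWithin_le_nhds)
  have hd : ∀ x ∈ Ioo a b, ∃ d, 0 ≤ d ∧ HasDerivAt (fun x => arctan (w x) + phaseG c δ x) d x := by
    intro x hx
    have hx' := Ioo_subset_Icc_self hx
    have P := hp x hx'
    have F := hpos x hx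
    have Gp := hgp x hx'
    have dg : HasDerivAt g (c * (-(2 * x))) x := by
      have := ((hasDerivAt_one_sub_sq x).add_const (δ / 2)).const_mul c
      exact this
    have dw := (((h.dp x).div dg Gp.ne').mul ((h.d1 x).inv F.ne')).arctan.add
      (phaseG_deriv c δ x (by linarith [hx.1]) (by linarith [hx.2]))
    refine ⟨_, ?_, dw⟩
    simp only [Pi.mul_apply, Pi.inv_apply, Pi.div_apply]
    have hgx : g x = c * (1 - x^2 + δ / 2) := rfl
    have hq : (χ - c^2 * x^2) * (1 - x^2) ≤ g x ^ 2 := by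
      rw [hgx]
      have : χ - c^2 * x^2 ≤ c^2 * (1 - x^2 + δ) := by linarith
      nlinarith [mul_le_mul_of_nonneg_right this P.le, sq_nonneg (c * δ)]
    have hgc : c * (1 - x^2) ≤ g x := by rw [hgx]; nlinarith
    have hx1 : |x| ≤ 1 := abs_le.2 ⟨by linarith [hx.1], by linarith [hx.2]⟩
    have hGe : c + (c * δ / 2 + 1) / (1 - x^2) = (g x + 1) / (1 - x^2) := by
      rw [hgx]; field_simp; ring
    rw [hGe]
    generalize χ - c^2 * x^2 = q at *
    generalize g x = G at *
    generalize f x = y at *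
    generalize f1 x = z at *
    generalize 1 - x^2 = p at *
    have e : (1 / (1 + (p * z / G * y⁻¹) ^ 2) * ((-(q * y) * G - p * z * (c * -(2 * x))) / G ^ 2 * y⁻¹ +
        p * z / G * (-z / y ^ 2)) + (G + 1) / p) =
        ((G + 1) * (G^2 * y^2 + p^2 * z^2) + p * (-(q * y^2) * G + 2 * c * x * p * z * y - p * z^2 * G)) /
          (p * (G^2 * y^2 + p^2 * z^2)) := by
      have : 0 < G^2 * y^2 + p^2 * z^2 := by positivity
      field_simp
      ring
    refine le_of_le_of_eq ?_ e.symm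
    apply div_nonneg _ (by positivity)
    have s1 : q * p * (y^2 * G) ≤ G^2 * (y^2 * G) := mul_le_mul_of_nonneg_right hq (by positivity)
    have s2 : -(2 * c * x * p^2 * (z * y)) ≤ G^2 * y^2 + p^2 * z^2 := by
      have a1 : -(2 * c * x * p^2 * (z * y)) ≤ |2 * c * x * p^2 * (z * y)| := neg_le_abs _
      have a2 : |2 * c * x * p^2 * (z * y)| = 2 * c * p^2 * |x| * |z * y| := by
        rw [abs_mul, abs_mul, abs_mul, abs_of_pos (by positivity : 0 < 2 * c), abs_of_pos (by positivity : 0 < p^2)]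
        ring
      have a3 : 2 * c * p^2 * |x| * |z * y| ≤ 2 * c * p^2 * 1 * |z * y| := by gcongr
      have a4 : 2 * c * p^2 * 1 * |z * y| ≤ 2 * G * p * |z * y| := by
        have := mul_le_mul_of_nonneg_right hgc (by positivity : 0 ≤ 2 * p * |z * y|)
        nlinarith
      have a5 : 2 * G * p * |z * y| ≤ G^2 * y^2 + p^2 * z^2 := by
        rw [abs_mul, abs_of_pos F]
        nlinarith [sq_nonneg (G * y - p * |z|), sq_abs z]
      linarith
    nlinarith
  have hm : ∀ x y, a < x → x ≤ y → y < b →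
      arctan (w x) + phaseG c δ x ≤ arctan (w y) + phaseG c δ y := by
    intro x y hx hxy hy
    choose! d hd0 hd1 using hd
    exact mono_helper (F := fun x => arctan (w x) + phaseG c δ x) (F' := d) (a := x) (b := y)
      (fun z hz => hd1 z ⟨by linarith [hz.1], by linarith [hz.2]⟩)
      (fun z hz => hd0 z ⟨by linarith [hz.1], by linarith [hz.2]⟩) le_rfl hxy le_rfl
  set m := (a + b) / 2 with hmdef
  have am : a < m := by rw [hmdef]; linarith
  have bm : m < b := by rw [hmdef]; linarith
  have r1 : π / 2 + phaseG c δ a ≤ arctan (w m) + phaseG c δ m := by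
    refine le_of_tendsto la ?_
    filter_upwards [Ioo_mem_nhdsGT am] with x hx using hm x m hx.1 hx.2.le bm
  have r2 : arctan (w m) + phaseG c δ m ≤ -(π / 2) + phaseG c δ b := by
    refine ge_of_tendsto lb ?_
    filter_upwards [Ioo_mem_nhdsLT bm] with x hx using hm m x am hx.1.le hx.2
  linarith

lemma sign_const {f : ℝ → ℝ} (hf : Continuous f) {a b : ℝ} (hne : ∀ x ∈ Ioo a b, f x ≠ 0) :
    (∀ x ∈ Ioo a b, 0 < f x) ∨ (∀ x ∈ Ioo a b, f x < 0) := by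
  by_contra hcon
  push Not at hcon
  obtain ⟨⟨x, hx, hx0⟩, ⟨y, hy, hy0⟩⟩ := hcon
  have := isPreconnected_Ioo.intermediate_value hx hy hf.continuousOn ⟨hx0, hy0⟩
  obtain ⟨z, hz, hz0⟩ := this
  exact hne z hz hz0

lemma spacing {c δ χ : ℝ} {f f1 f2 : ℝ → ℝ} (h : Prol c χ f f1 f2) (hc : 0 < c) (hδ : 0 < δ)
    (hχ : χ ≤ c^2 * (1 + δ)) {a b : ℝ} (ha : -1 < a)
    (hab : a < b) (hb : b < 1) (h0 : f a = 0) (h1 : f b = 0) (hne : ∀ x ∈ Ioo a b, f x ≠ 0) :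
    π ≤ phaseG c δ b - phaseG c δ a := by
  rcases sign_const h.c0 hne with hp | hp
  · exact spacing_pos h hc hδ hχ ha hab hb h0 h1 hp
  · exact spacing_pos h.neg hc hδ hχ ha hab hb (by simp [h0]) (by simp [h1]) (fun x hx => by simpa using hp x hx)

lemma endpoint_pos {c δ χ : ℝ} {f f1 f2 : ℝ → ℝ} (h : Prol c χ f f1 f2) (hc : 0 < c) (hδ : 0 < δ)
    (hχ : χ ≤ c^2 * (1 + δ)) {z : ℝ} (hz0 : 0 ≤ z) (hz1 : z < 1) (hfz : f z = 0)
    (hpos : ∀ x ∈ Ioo z 1, 0 < f x) : 1 ≤ c^2 * (δ + 2 * (1 - z)) * (1 - z) := by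
  obtain ⟨y, hy, hmax⟩ := isCompact_Icc.exists_isMaxOn (nonempty_Icc.2 hz1.le) h.c0.continuousOn
  have hM : ∀ x ∈ Icc z 1, f x ≤ f y := fun x hx => hmax hx
  have hM0 : 0 < f y := lt_of_lt_of_le (hpos ((z + 1) / 2) ⟨by linarith, by linarith⟩)
    (hM _ ⟨by linarith, by linarith⟩)
  set Q := c^2 * (δ + 2 * (1 - z)) with hQ
  have hQ0 : 0 < Q := by
    have : 0 < δ + 2 * (1 - z) := by linarith
    positivity
  have s1 : ∀ x ∈ Ioo z 1, f1 x ≤ Q * f y := by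
    intro x hx
    have := mono_helper (F := fun x => (1 - x^2) * f1 x + Q * f y * x)
      (F' := fun x => -((χ - c^2 * x^2) * f x) + Q * f y) (a := x) (b := 1)
      (fun u _ => ((h.dp u).add ((hasDerivAt_id u).const_mul (Q * f y))).congr_deriv (by simp)) ?_
      le_rfl hx.2.le le_rfl
    · have e : (1 - x) * ((1 + x) * f1 x) ≤ (1 - x) * (Q * f y) := by nlinarith
      have e2 := le_of_mul_le_mul_left e (by linarith [hx.2])
      by_contra hcon
      push Not at hcon
      have : 0 < Q * f y := by positivity
      nlinarith [hx.1, mul_pos (this.trans hcon) (show 0 < 1 + x by linarith [hx.1])]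
    · intro u hu
      have hu' : u ∈ Ioo z 1 := ⟨hx.1.trans hu.1, hu.2⟩
      have f0 := hpos u hu'
      have fM := hM u (Ioo_subset_Icc_self hu')
      have : χ - c^2 * u^2 ≤ Q := by
        rw [hQ]
        have : 1 - u^2 ≤ 2 * (1 - z) := by nlinarith [hu'.1, hu'.2]
        nlinarith [mul_le_mul_of_nonneg_left this (sq_nonneg c)]
      have a1 := mul_le_mul_of_nonneg_right this f0.le
      have a2 := mul_le_mul_of_nonneg_left fM hQ0.le
      linarith
  have s2 := mono_helper (F := fun x => Q * f y * x - f x) (F' := fun x => Q * f y - f1 x) (a := z) (b := 1)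
    (fun u _ => (((hasDerivAt_id u).const_mul (Q * f y)).sub (h.d1 u)).congr_deriv (by simp))
    (fun u hu => by linarith [s1 u hu]) le_rfl hy.1 hy.2
  simp only [hfz] at s2
  have s3 : f y * 1 ≤ f y * (Q * (1 - z)) := by
    have : Q * f y * (y - z) ≤ Q * f y * (1 - z) := mul_le_mul_of_nonneg_left (by linarith [hy.2]) (by positivity)
    linarith
  exact le_of_mul_le_mul_left s3 hM0

lemma endpoint {c δ χ : ℝ} {f f1 f2 : ℝ → ℝ} (h : Prol c χ f f1 f2) (hc : 0 < c) (hδ : 0 < δ)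
    (hχ : χ ≤ c^2 * (1 + δ)) {z : ℝ} (hz0 : 0 ≤ z) (hz1 : z < 1) (hfz : f z = 0)
    (hne : ∀ x ∈ Ioo z 1, f x ≠ 0) : 1 ≤ c^2 * (δ + 2 * (1 - z)) * (1 - z) := by
  rcases sign_const h.c0 hne with hp | hp
  · exact endpoint_pos h hc hδ hχ hz0 hz1 hfz hp
  · exact endpoint_pos h.neg hc hδ hχ hz0 hz1 (by simp [hfz]) (fun x hx => by simpa using hp x hx)

lemma phaseG_neg (c δ x : ℝ) : phaseG c δ (-x) = - phaseG c δ x := by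
  unfold phaseG
  rw [sub_neg_eq_add, ← sub_eq_add_neg]
  ring

lemma count_zeros {c δ χ : ℝ} {f f1 f2 : ℝ → ℝ} (h : Prol c χ f f1 f2) (hc : 0 < c) (hδ : 0 < δ)
    (hχ : χ ≤ c^2 * (1 + δ)) {n : ℕ} (hn : 0 < n) (t : Fin n → ℝ) (ht_mono : StrictMono t)
    (ht_mem : ∀ j, t j ∈ Set.Ioo (-1:ℝ) 1) (ht_zero : ∀ j, f (t j) = 0)
    (hall : ∀ x ∈ Ioo (-1:ℝ) 1, f x = 0 → ∃ j, t j = x)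
    (hsym : ∀ x, f x = 0 → f (-x) = 0) :
    ∃ z, 0 ≤ z ∧ z < 1 ∧ ((n:ℝ) - 1) * π ≤ 2 * phaseG c δ z ∧
      1 ≤ c^2 * (δ + 2 * (1 - z)) * (1 - z) := by
  have hind : ∀ k : ℕ, ∀ hk : k < n, (k:ℝ) * π ≤ phaseG c δ (t ⟨k, hk⟩) - phaseG c δ (t ⟨0, hn⟩) := by
    intro k
    induction k with
    | zero => intro hk; simp
    | succ k ih =>
      intro hk
      have hk' : k < n := by omega
      have h1 := ih hk'
      have hlt : t ⟨k, hk'⟩ < t ⟨k + 1, hk⟩ := ht_mono (by simp [Fin.lt_def])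
      have h2 := spacing h hc hδ hχ (ht_mem ⟨k, hk'⟩).1 hlt (ht_mem ⟨k + 1, hk⟩).2 (ht_zero _) (ht_zero _) ?_
      · push_cast; linarith
      · intro x hx hx0
        obtain ⟨j, rfl⟩ := hall x ⟨(ht_mem ⟨k, hk'⟩).1.trans hx.1, hx.2.trans (ht_mem ⟨k + 1, hk⟩).2⟩ hx0
        have a1 := ht_mono.lt_iff_lt.1 hx.1
        have a2 := ht_mono.lt_iff_lt.1 hx.2
        rw [Fin.lt_def] at a1 a2
        simp only at a1 a2
        omega
  have hlast : n - 1 < n := by omega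
  set z := t ⟨n - 1, hlast⟩ with hz
  have hle : ∀ j, t j ≤ z := by
    intro j
    apply ht_mono.monotone
    rw [Fin.le_def]
    simp only
    omega
  have hge : ∀ j, -z ≤ t j := by
    intro j
    have hj := ht_mem j
    obtain ⟨i, hi⟩ := hall (-(t j)) ⟨by linarith [hj.2], by linarith [hj.1]⟩ (hsym _ (ht_zero j))
    have := hle i
    linarith
  have hz0 : 0 ≤ z := by linarith [hle ⟨0, hn⟩, hge ⟨0, hn⟩]
  have hz1 : z < 1 := (ht_mem _).2
  refine ⟨z, hz0, hz1, ?_, ?_⟩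
  · have a := hind (n - 1) hlast
    have b : phaseG c δ (-z) ≤ phaseG c δ (t ⟨0, hn⟩) := by
      refine mono_helper (F' := fun x => c + (c * δ / 2 + 1) / (1 - x^2)) (a := -z) (b := z) ?_ ?_
        le_rfl (hge _) (hle _)
      · intro x hx
        exact phaseG_deriv c δ x (by linarith [hx.1]) (by linarith [hx.2])
      · intro x hx
        have : 0 < 1 - x^2 := by nlinarith [hx.1, hx.2]
        positivity
    rw [phaseG_neg] at b
    rw [Nat.cast_sub (by omega : 1 ≤ n)] at a
    push_cast at a
    linarith
  · refine endpoint h hc hδ hχ hz0 hz1 (ht_zero _) ?_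
    intro x hx hx0
    obtain ⟨j, rfl⟩ := hall x ⟨by linarith [hx.1], hx.2⟩ hx0
    linarith [hle j, hx.1]

lemma log15_lower : (2.7:ℝ) ≤ Real.log 15 := by
  rw [Real.le_log_iff_exp_le (by norm_num)]
  have h : exp 2.7 ^ 10 ≤ (15:ℝ) ^ 10 := by
    rw [← Real.exp_nat_mul]
    have : ((10:ℕ):ℝ) * 2.7 = ((27:ℕ):ℝ) * 1 := by norm_num
    rw [this, Real.exp_nat_mul]
    calc exp 1 ^ 27 ≤ (2.7182818286:ℝ) ^ 27 := by
          gcongr; exact Real.exp_one_lt_d9.le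
      _ ≤ 15 ^ 10 := by norm_num
  exact le_of_pow_le_pow_left₀ (by norm_num) (by norm_num) h

lemma log15_upper : Real.log 15 ≤ (2.75:ℝ) := by
  rw [Real.log_le_iff_le_exp (by norm_num)]
  have h : (15:ℝ) ^ 4 ≤ exp 2.75 ^ 4 := by
    rw [← Real.exp_nat_mul]
    have : ((4:ℕ):ℝ) * 2.75 = ((11:ℕ):ℝ) * 1 := by norm_num
    rw [this, Real.exp_nat_mul]
    calc (15:ℝ) ^ 4 ≤ (2.7182818283:ℝ) ^ 11 := by norm_num
      _ ≤ exp 1 ^ 11 := by gcongr; exact Real.exp_one_gt_d9.le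
  exact le_of_pow_le_pow_left₀ (by norm_num) (by positivity) h

lemma ell_lower {c : ℝ} (hc : 30 < c) : 2.7 ≤ Real.log (c / 2) :=
  log15_lower.trans (Real.log_le_log (by norm_num) (by linarith))

lemma ell_upper {c : ℝ} (hc : 30 < c) : Real.log (c / 2) ≤ 0.0987 * c := by
  have h1 : c / 2 = 15 * (c / 30) := by ring
  rw [h1, Real.log_mul (by norm_num) (by positivity)]
  have := Real.log_le_sub_one_of_pos (show 0 < c / 30 by positivity)
  have := log15_upper
  linarith

/-- The eigenvalue `χ` is large. -/
lemma chi_large {c χ : ℝ} {f f1 f2 : ℝ → ℝ} (h : Prol c χ f f1 f2) (hc : 30 < c)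
    {n : ℕ} (hn : 0 < n) (t : Fin n → ℝ) (ht_mono : StrictMono t)
    (ht_mem : ∀ j, t j ∈ Set.Ioo (-1:ℝ) 1) (ht_zero : ∀ j, f (t j) = 0)
    (hall : ∀ x ∈ Ioo (-1:ℝ) 1, f x = 0 → ∃ j, t j = x)
    (hsym : ∀ x, f x = 0 → f (-x) = 0)
    (hbig : (n : ℝ) > 2*c/π + 5 * Real.log c * Real.log (c/2)) :
    c^2 * (1 + 4.5 * Real.log (c / 2) / c)^2 < χ := by
  by_contra hcon
  push Not at hcon
  set l := Real.log (c / 2) with hl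
  have l1 : 2.7 ≤ l := ell_lower hc
  have l2 : l ≤ 0.0987 * c := ell_upper hc
  have hc0 : 0 < c := by linarith
  have hl0 : 0 < l := by linarith
  set e := 4.5 * l / c with he
  have he0 : 0 < e := by positivity
  have hce : c * e = 4.5 * l := by rw [he]; field_simp
  obtain ⟨z, hz0, hz1, hG, hE⟩ := count_zeros h hc0 (δ := 2 * e + e^2) (by positivity)
    (by nlinarith) hn t ht_mono ht_mem ht_zero hall hsym
  have he1 : e ≤ 0.45 := by
    have : c * e ≤ c * 0.45 := by rw [hce]; linarith
    exact le_of_mul_le_mul_left this hc0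
  have hB : c * (2 * e + e^2) ≤ 11 * l := by
    have : c * (2 * e + e^2) = 4.5 * l * (2 + e) := by rw [← hce]; ring
    rw [this]
    have e2 : e ≤ 4.5 * 0.0987 := by
      have : c * e ≤ c * (4.5 * 0.0987) := by rw [hce]; linarith
      exact le_of_mul_le_mul_left this hc0
    nlinarith
  have hh : 0 < 1 - z := by linarith
  have hinv : 1 / (1 - z) ≤ 12 * c * l := by
    by_contra hcon2
    push Not at hcon2
    have h1 : 12 * c * l * (1 - z) < 1 := by
      rw [lt_div_iff₀ hh] at hcon2
      exact hcon2
    have h2 : c^2 * (2 * e + e^2 + 2 * (1 - z)) * (1 - z) =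
        c * (c * (2 * e + e^2)) * (1 - z) + 2 * (c * (1 - z))^2 := by ring
    rw [h2] at hE
    have h3 : c * (c * (2 * e + e^2)) * (1 - z) ≤ c * (11 * l) * (1 - z) := by gcongr
    have h4 : 0 < c * (1 - z) := by positivity
    set y := c * (1 - z) with hy
    have h5 : 12 * l * y < 1 := by rw [hy]; linarith
    have h6 : 1 ≤ 11 * l * y + 2 * y^2 := by rw [hy]; rw [hy] at hE; linarith
    have h7 : 2 * y ≤ l := by nlinarith
    nlinarith
  have hlog : Real.log (1 + z) - Real.log (1 - z) ≤ 2 * l + 3.16 := by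
    have g1 : Real.log (1 + z) ≤ Real.log 2 := Real.log_le_log (by linarith) (by linarith)
    have g2 : -Real.log (1 - z) ≤ Real.log (12 * c * l) := by
      rw [← Real.log_inv, ← one_div]
      exact Real.log_le_log (by positivity) hinv
    have g3 : Real.log (12 * c * l) ≤ Real.log 16 + Real.log (2 * (c / 2)) + Real.log l := by
      rw [← Real.log_mul (by norm_num) (by positivity), ← Real.log_mul (by positivity) (by positivity)]
      apply Real.log_le_log (by positivity)
      nlinarith [mul_pos hc0 hl0]
    have g4 : Real.log (2 * (c / 2)) = Real.log 2 + l := Real.log_mul (by norm_num) (by positivity)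
    have g5 : Real.log l ≤ l - 1 := Real.log_le_sub_one_of_pos hl0
    have g6 : Real.log 16 = 4 * Real.log 2 := by
      rw [show (16:ℝ) = 2 ^ 4 by norm_num, Real.log_pow]; norm_num
    have := Real.log_two_lt_d9
    linarith
  have hlogc : Real.log c = Real.log 2 + l := by
    rw [hl, ← Real.log_mul (by norm_num) (by positivity)]; congr 1; ring
  have hlog0 : 0 ≤ Real.log (1 + z) - Real.log (1 - z) :=
    sub_nonneg.2 (Real.log_le_log hh (by linarith))
  have hG2 : 2 * phaseG c (2 * e + e^2) z ≤ 2 * c + (5.5 * l + 1) * (2 * l + 3.16) := by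
    unfold phaseG
    have k1 : c * z ≤ c * 1 := by gcongr
    have k2 : (c * (2 * e + e^2) / 2 + 1) * (Real.log (1 + z) - Real.log (1 - z)) ≤
        (5.5 * l + 1) * (2 * l + 3.16) := by
      apply mul_le_mul _ hlog hlog0 (by positivity)
      linarith
    linarith
  have hpi := Real.pi_gt_d2
  have hpi2 := Real.pi_lt_d2
  have hfin : (n:ℝ) * π > 2 * c + 5 * Real.log c * l * π := by
    have := mul_lt_mul_of_pos_right hbig Real.pi_pos
    have e2 : (2*c/π + 5 * Real.log c * l) * π = 2 * c + 5 * Real.log c * l * π := by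
      field_simp
    linarith
  rw [hlogc] at hfin
  have k3 : 5 * (0.693 + l) * l * 3.14 ≤ 5 * (Real.log 2 + l) * l * π := by
    have := Real.log_two_gt_d9
    gcongr
    linarith
  nlinarith

/-- Positivity of the normalized solution beyond `1`. -/
lemma grow_pos {c χ x0 : ℝ} {f f1 f2 : ℝ → ℝ} (h : Prol c χ f f1 f2) (hf1 : f 1 = 1)
    (hx0 : 1 < x0) (hχ : χ = c^2 * x0^2) : ∀ x ∈ Icc 1 x0, 0 < f x := by
  have hq : ∀ x ∈ Icc 1 x0, 0 ≤ χ - c^2 * x^2 := by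
    intro x hx
    have : x^2 ≤ x0^2 := by
      have := hx.1
      have := hx.2
      gcongr
    rw [hχ]
    nlinarith [mul_le_mul_of_nonneg_left this (sq_nonneg c)]
  have s1 : ∀ x ∈ Icc 1 x0, 0 ≤ (x^2 - 1) * (f x * f1 x) := by
    intro x hx
    have := mono_helper (F := fun x => -((1 - x^2) * f1 x * f x))
      (F' := fun x => (χ - c^2 * x^2) * f x ^ 2 + (x^2 - 1) * f1 x ^ 2) (a := 1) (b := x0)
      (fun u _ => ((h.dp u).mul (h.d1 u)).neg.congr_deriv (by ring))
      (fun u hu => by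
        have a1 := hq u (Ioo_subset_Icc_self hu)
        have a2 : 0 ≤ u^2 - 1 := by nlinarith [hu.1]
        positivity) le_rfl hx.1 hx.2
    linarith
  have s2 : ∀ x ∈ Icc 1 x0, 1 ≤ f x ^ 2 := by
    intro x hx
    have := mono_helper (F := fun x => f x ^ 2) (F' := fun x => 2 * (f x * f1 x)) (a := 1) (b := x0)
      (fun u _ => ((h.d1 u).pow 2).congr_deriv (by push_cast; ring))
      (fun u hu => by
        have a1 := s1 u (Ioo_subset_Icc_self hu)
        have a2 : 0 < u^2 - 1 := by nlinarith [hu.1]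
        have := nonneg_of_mul_nonneg_right a1 a2
        linarith) le_rfl hx.1 hx.2
    simp only [hf1] at this
    linarith
  intro x hx
  by_contra hcon
  push Not at hcon
  have := intermediate_value_Icc' hx.1 h.c0.continuousOn
  obtain ⟨y, hy, hy0⟩ := this (⟨hcon, by rw [hf1]; norm_num⟩ : (0:ℝ) ∈ Icc (f x) (f 1))
  have := s2 y ⟨hy.1, hy.2.trans hx.2⟩
  rw [hy0] at this
  norm_num at this

lemma grow_step {c χ κ a b : ℝ} {f f1 f2 : ℝ → ℝ} (h : Prol c χ f f1 f2)
    (ha : 1 ≤ a) (hab : a ≤ b) (hκ : 0 ≤ κ) (hpos : ∀ x ∈ Icc a b, 0 < f x)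
    (hcond : κ^2 * (b^2 - 1) + 2 * κ * b ≤ χ - c^2 * b^2)
    (hinit : 0 ≤ (a^2 - 1) * (f1 a - κ * f a)) :
    exp (κ * (b - a)) * f a ≤ f b ∧ 0 ≤ (b^2 - 1) * (f1 b - κ * f b) := by
  have hq : ∀ x ∈ Icc a b, κ^2 * (x^2 - 1) + 2 * κ * x ≤ χ - c^2 * x^2 := by
    intro x hx
    have h1 : x^2 ≤ b^2 := by
      have := ha.trans hx.1
      have := hx.2
      gcongr
    nlinarith [mul_le_mul_of_nonneg_left h1 (sq_nonneg c), mul_le_mul_of_nonneg_left h1 (sq_nonneg κ),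
      mul_le_mul_of_nonneg_left hx.2 hκ]
  have s1 : ∀ x ∈ Icc a b, 0 ≤ (x^2 - 1) * (f1 x - κ * f x) := by
    intro x hx
    have hex : ∀ u : ℝ, HasDerivAt (fun x => exp (κ * x)) (exp (κ * u) * κ) u := by
      intro u
      have := ((hasDerivAt_id u).const_mul κ).exp
      exact this.congr_deriv (by simp)
    have := mono_helper (F := fun x => exp (κ * x) * (-((1 - x^2) * f1 x) + κ * ((1 - x^2) * f x)))
      (F' := fun x => exp (κ * x) * ((χ - c^2 * x^2 - (κ^2 * (x^2 - 1) + 2 * κ * x)) * f x)) (a := a) (b := b)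
      (fun u _ => ((hex u).mul ((h.dp u).neg.add (((hasDerivAt_one_sub_sq u).mul (h.d1 u)).const_mul κ))).congr_deriv
        (by simp only [Pi.add_apply, Pi.neg_apply, Pi.mul_apply]; ring))
      (fun u hu => by
        have a1 := hq u (Ioo_subset_Icc_self hu)
        have a2 := hpos u (Ioo_subset_Icc_self hu)
        exact mul_nonneg (exp_pos _).le (mul_nonneg (by linarith) a2.le)) le_rfl hx.1 hx.2
    have h2 : 0 ≤ exp (κ * a) * (-((1 - a^2) * f1 a) + κ * ((1 - a^2) * f a)) :=
      mul_nonneg (exp_pos _).le (by linarith)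
    have h3 := nonneg_of_mul_nonneg_right (h2.trans this) (exp_pos _)
    linarith
  refine ⟨?_, s1 b ⟨hab, le_rfl⟩⟩
  have hex : ∀ u : ℝ, HasDerivAt (fun x => exp (-(κ * x))) (exp (-(κ * u)) * (-κ)) u := by
    intro u
    have := ((hasDerivAt_id u).const_mul κ).neg.exp
    exact this.congr_deriv (by simp)
  have := mono_helper (F := fun x => exp (-(κ * x)) * f x)
    (F' := fun x => exp (-(κ * x)) * (f1 x - κ * f x)) (a := a) (b := b)
    (fun u _ => ((hex u).mul (h.d1 u)).congr_deriv (by ring))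
    (fun u hu => by
      have a1 := s1 u (Ioo_subset_Icc_self hu)
      have a2 : 0 < u^2 - 1 := by nlinarith [hu.1]
      exact mul_nonneg (exp_pos _).le (nonneg_of_mul_nonneg_right a1 a2)) le_rfl hab le_rfl
  have e1 : exp (κ * (b - a)) = exp (κ * b) * exp (-(κ * a)) := by rw [← exp_add]; congr 1; ring
  have e2 : exp (κ * b) * exp (-(κ * b)) = 1 := by rw [← exp_add]; simp
  rw [e1, mul_assoc]
  calc exp (κ * b) * (exp (-(κ * a)) * f a) ≤ exp (κ * b) * (exp (-(κ * b)) * f b) :=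
        mul_le_mul_of_nonneg_left this (exp_pos _).le
    _ = f b := by rw [← mul_assoc, e2, one_mul]

lemma grow {c χ e : ℝ} {f f1 f2 : ℝ → ℝ} (h : Prol c χ f f1 f2) (hf1 : f 1 = 1) (hc : 30 < c)
    (he : 0 < e) (hce : 12 ≤ c * e) (hχ : χ = c^2 * (1 + e)^2) :
    exp (0.725 * (c * e)) ≤ f (1 + 3 * e / 4) := by
  have hpos := grow_pos h hf1 (x0 := 1 + e) (by linarith) hχ
  have hc0 : 0 < c := by linarith
  have hee : 12 * e ≤ c * e * e := by gcongr
  have a1 := grow_step h (κ := 1.5 * c) (a := 1) (b := 1 + e / 4) le_rfl (by linarith) (by positivity)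
    (fun x hx => hpos x ⟨hx.1, by linarith [hx.2]⟩)
    (by
      rw [hχ]
      have : 0 ≤ c * (c * e * (0.375 + 0.796875 * e) - (3 + 0.75 * e)) := by
        apply mul_nonneg hc0.le; nlinarith
      nlinarith) (by norm_num)
  have p1 := hpos (1 + e / 4) ⟨by linarith, by linarith⟩
  have q1 : 0 ≤ (1 + e / 4)^2 - 1 := by nlinarith
  have a2 := grow_step h (κ := 0.9 * c) (a := 1 + e / 4) (b := 1 + e / 2) (by linarith) (by linarith) (by positivity)
    (fun x hx => hpos x ⟨by linarith [hx.1], by linarith [hx.2]⟩)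
    (by
      rw [hχ]
      have : 0 ≤ c * (c * e * (0.19 + 0.5475 * e) - (1.8 + 0.9 * e)) := by
        apply mul_nonneg hc0.le; nlinarith
      nlinarith)
    (by nlinarith [a1.2, mul_nonneg q1 (mul_pos hc0 p1).le])
  have p2 := hpos (1 + e / 2) ⟨by linarith, by linarith⟩
  have q2 : 0 ≤ (1 + e / 2)^2 - 1 := by nlinarith
  have a3 := grow_step h (κ := 0.5 * c) (a := 1 + e / 2) (b := 1 + 3 * e / 4) (by linarith) (by linarith) (by positivity)
    (fun x hx => hpos x ⟨by linarith [hx.1], by linarith [hx.2]⟩)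
    (by
      rw [hχ]
      have : 0 ≤ c * (c * e * (0.125 + 0.296875 * e) - (1 + 0.75 * e)) := by
        apply mul_nonneg hc0.le; nlinarith
      nlinarith)
    (by nlinarith [a2.2, mul_nonneg q2 (mul_pos hc0 p2).le])
  have b1 := a1.1
  have b2 := a2.1
  have b3 := a3.1
  rw [hf1, mul_one] at b1
  calc exp (0.725 * (c * e)) = exp (0.5 * c * (1 + 3 * e / 4 - (1 + e / 2))) *
        (exp (0.9 * c * (1 + e / 2 - (1 + e / 4))) * exp (1.5 * c * (1 + e / 4 - 1))) := by
        rw [← exp_add, ← exp_add]; congr 1; ring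
    _ ≤ exp (0.5 * c * (1 + 3 * e / 4 - (1 + e / 2))) *
        (exp (0.9 * c * (1 + e / 2 - (1 + e / 4))) * f (1 + e / 4)) := by gcongr
    _ ≤ exp (0.5 * c * (1 + 3 * e / 4 - (1 + e / 2))) * f (1 + e / 2) := by gcongr
    _ ≤ _ := b3

lemma exp_big {c e : ℝ} (hc : 30 < c) (he : 4.5 * Real.log (c / 2) ≤ c * e) (he0 : 0 < e) :
    2 * c^2 * (2 + e) < exp (0.725 * (c * e)) := by
  have l1 := ell_lower hc
  have hc0 : 0 < c := by linarith
  set l := Real.log (c / 2) with hl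
  have h1 : 2 + e ≤ 2 * exp (e / 2) := by
    have := add_one_le_exp (e / 2)
    linarith
  have h2 : c = 2 * exp l := by rw [hl, exp_log (by positivity)]; ring
  have h3 : (16:ℝ) < exp (1.187 * l) := by
    have : (16:ℝ) < exp 3 := by
      have : exp 3 = exp 1 ^ 3 := by rw [← exp_nat_mul]; norm_num
      rw [this]
      calc (16:ℝ) < 2.7182818283 ^ 3 := by norm_num
        _ ≤ exp 1 ^ 3 := by gcongr; exact Real.exp_one_gt_d9.le
    exact this.trans_le (exp_le_exp.2 (by linarith))
  have h4 : 2 * c^2 * (2 + e) ≤ 16 * (exp (2 * l) * exp (e / 2)) := by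
    have : exp (2 * l) = exp l ^ 2 := by rw [← exp_nat_mul]; norm_num
    rw [this]
    have : c^2 = 4 * exp l ^ 2 := by nth_rewrite 1 [h2]; ring
    rw [this]
    have := mul_le_mul_of_nonneg_left h1 (show 0 ≤ 8 * exp l ^ 2 by positivity)
    linarith
  calc 2 * c^2 * (2 + e) ≤ 16 * (exp (2 * l) * exp (e / 2)) := h4
    _ < exp (1.187 * l) * (exp (2 * l) * exp (e / 2)) := by gcongr
    _ = exp (3.187 * l + e / 2) := by rw [← exp_add, ← exp_add]; congr 1; ring
    _ ≤ exp (0.725 * (c * e)) := by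
      apply exp_le_exp.2
      nlinarith

/-- Sonin-type bound inside the interval. -/
lemma sonin {c χ : ℝ} {f f1 f2 : ℝ → ℝ} (h : Prol c χ f f1 f2) (hχ : c^2 < χ) {x : ℝ}
    (hx : x ∈ Icc (0:ℝ) 1) : f x ^ 2 + (1 - x^2) * f1 x ^ 2 / (χ - c^2 * x^2) ≤ f 1 ^ 2 := by
  have hq : ∀ u ∈ Icc (0:ℝ) 1, 0 < χ - c^2 * u^2 := by
    intro u hu
    have : u^2 ≤ 1 := by nlinarith [hu.1, hu.2]
    nlinarith [mul_le_mul_of_nonneg_left this (sq_nonneg c)]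
  have hdq : ∀ u : ℝ, HasDerivAt (fun u => χ - c^2 * u^2) (-(2 * c^2 * u)) u := by
    intro u
    exact (((hasDerivAt_pow 2 u).const_mul (c^2)).const_sub χ).congr_deriv (by push_cast; ring)
  have := mono_helper (F := fun x => f x ^ 2 + (1 - x^2) * f1 x ^ 2 / (χ - c^2 * x^2))
    (F' := fun x => f1 x ^ 2 * (2 * x * (χ - c^2 * x^2) + 2 * c^2 * x * (1 - x^2)) / (χ - c^2 * x^2)^2)
    (a := 0) (b := 1) ?_ ?_ hx.1 hx.2 le_rfl
  · simpa using this
  · intro u hu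
    have Q := hq u hu
    refine (((h.d1 u).pow 2).add ((((hasDerivAt_one_sub_sq u).mul ((h.d2 u).pow 2))).div (hdq u) Q.ne')).congr_deriv ?_
    simp only [Pi.mul_apply, Pi.pow_apply]
    have O := h.ode u
    push_cast
    generalize χ - c^2 * u^2 = q at *
    have hQ2 : q ≠ 0 := Q.ne'
    field_simp
    have : (1 - u^2) * f2 u = 2 * u * f1 u - q * f u := by linarith
    linear_combination q * f1 u * this
  · intro u hu
    have Q := hq u (Ioo_subset_Icc_self hu)
    have : 0 ≤ 1 - u^2 := by nlinarith [hu.1, hu.2]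
    have := hu.1
    positivity

lemma eig_re_im {c : ℝ} {ψ : ℝ → ℝ} {lam : ℂ} (hψ : Continuous ψ)
    (heig : ∀ x : ℝ, lam * (ψ x : ℂ) =
      ∫ t in (-1:ℝ)..1, (ψ t : ℂ) * Complex.exp (Complex.I * (c:ℂ) * (x:ℂ) * (t:ℂ))) (x : ℝ) :
    lam.re * ψ x = (∫ t in (-1:ℝ)..1, ψ t * cos (c * x * t)) ∧
    lam.im * ψ x = (∫ t in (-1:ℝ)..1, ψ t * sin (c * x * t)) := by
  have hcont : Continuous fun t : ℝ =>
      (ψ t : ℂ) * Complex.exp (Complex.I * (c:ℂ) * (x:ℂ) * (t:ℂ)) := by fun_prop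
  have hexp : ∀ t : ℝ, Complex.exp (Complex.I * (c:ℂ) * (x:ℂ) * (t:ℂ)) =
      Complex.exp (((c * x * t : ℝ) : ℂ) * Complex.I) := by
    intro t; congr 1; push_cast; ring
  constructor
  · have h := Complex.reCLM.intervalIntegral_comp_comm (hcont.intervalIntegrable (μ := volume) (-1) 1)
    rw [← heig x] at h
    simp only [Complex.reCLM_apply, hexp, Complex.re_mul_ofReal, Complex.re_ofReal_mul,
      Complex.exp_ofReal_mul_I_re] at h
    exact h.symm
  · have h := Complex.imCLM.intervalIntegral_comp_comm (hcont.intervalIntegrable (μ := volume) (-1) 1)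
    rw [← heig x] at h
    simp only [Complex.imCLM_apply, hexp, Complex.im_mul_ofReal, Complex.im_ofReal_mul,
      Complex.exp_ofReal_mul_I_im] at h
    exact h.symm

lemma eig_parity {c : ℝ} {ψ : ℝ → ℝ} {lam : ℂ} (hψ : Continuous ψ) (hlam : lam ≠ 0)
    (heig : ∀ x : ℝ, lam * (ψ x : ℂ) =
      ∫ t in (-1:ℝ)..1, (ψ t : ℂ) * Complex.exp (Complex.I * (c:ℂ) * (x:ℂ) * (t:ℂ))) (x : ℝ) :
    |ψ (-x)| = |ψ x| := by
  obtain ⟨a1, a2⟩ := eig_re_im hψ heig x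
  obtain ⟨b1, b2⟩ := eig_re_im hψ heig (-x)
  have e1 : lam.re * ψ (-x) = lam.re * ψ x := by
    rw [a1, b1]; congr 1; ext t
    rw [show c * -x * t = -(c * x * t) by ring, cos_neg]
  have e2 : lam.im * ψ (-x) = -(lam.im * ψ x) := by
    rw [a2, b2, ← intervalIntegral.integral_neg]; congr 1; ext t
    rw [show c * -x * t = -(c * x * t) by ring, sin_neg]; ring
  by_cases hre : lam.re = 0
  · have him : lam.im ≠ 0 := fun h => hlam (Complex.ext hre h)
    have : ψ (-x) = -ψ x := mul_left_cancel₀ him (by rw [e2]; ring)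
    rw [this, abs_neg]
  · rw [mul_left_cancel₀ hre e1]

lemma eig_bound {c : ℝ} {ψ : ℝ → ℝ} {lam : ℂ} {M : ℝ}
    (heig : ∀ x : ℝ, lam * (ψ x : ℂ) =
      ∫ t in (-1:ℝ)..1, (ψ t : ℂ) * Complex.exp (Complex.I * (c:ℂ) * (x:ℂ) * (t:ℂ)))
    (hM : ∀ x ∈ Icc (-1:ℝ) 1, |ψ x| ≤ M) (x : ℝ) : ‖lam‖ * |ψ x| ≤ 2 * M := by
  have h : ‖lam * (ψ x : ℂ)‖ ≤ M * |1 - (-1:ℝ)| := by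
    rw [heig x]
    apply intervalIntegral.norm_integral_le_of_norm_le_const
    intro t ht
    rw [uIoc_of_le (by norm_num)] at ht
    have hexp : Complex.exp (Complex.I * (c:ℂ) * (x:ℂ) * (t:ℂ)) =
        Complex.exp (((c * x * t : ℝ) : ℂ) * Complex.I) := by
      congr 1; push_cast; ring
    rw [hexp, norm_mul, Complex.norm_exp_ofReal_mul_I, mul_one, Complex.norm_real]
    exact hM t ⟨ht.1.le, ht.2⟩
  rw [norm_mul, Complex.norm_real, Real.norm_eq_abs] at h
  norm_num at h
  linarith

lemma eig_I0 {c : ℝ} {ψ : ℝ → ℝ} {lam : ℂ}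
    (heig : ∀ x : ℝ, lam * (ψ x : ℂ) =
      ∫ t in (-1:ℝ)..1, (ψ t : ℂ) * Complex.exp (Complex.I * (c:ℂ) * (x:ℂ) * (t:ℂ))) :
    |∫ s in (-1:ℝ)..1, ψ s| = ‖lam‖ * |ψ 0| := by
  have h := heig 0
  simp only [Complex.ofReal_zero, mul_zero, zero_mul, Complex.exp_zero, mul_one] at h
  rw [intervalIntegral.integral_ofReal] at h
  have h2 := congrArg norm h
  rw [norm_mul, Complex.norm_real, Complex.norm_real] at h2
  exact h2.symm

lemma eig_I1 {c : ℝ} {ψ : ℝ → ℝ} {lam : ℂ} {d : ℝ} (hψ : Continuous ψ) (hd : HasDerivAt ψ d 0)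
    (heig : ∀ x : ℝ, lam * (ψ x : ℂ) =
      ∫ t in (-1:ℝ)..1, (ψ t : ℂ) * Complex.exp (Complex.I * (c:ℂ) * (x:ℂ) * (t:ℂ))) :
    |c| * |∫ s in (-1:ℝ)..1, s * ψ s| ≤ ‖lam‖ * |d| := by
  have h1 := param_deriv (fun x t => ψ t * sin (c * x * t)) (fun x t => ψ t * (cos (c * x * t) * (c * t)))
    (by unfold Function.uncurry; fun_prop) (by unfold Function.uncurry; fun_prop)
    (by
      intro x s
      have : HasDerivAt (fun y : ℝ => c * y * s) (c * s) x := by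
        have := ((hasDerivAt_id x).const_mul c).mul_const s
        simpa using this
      exact this.sin.const_mul (ψ s)) (-1) 1 0
  have h2 : HasDerivAt (fun x => lam.im * ψ x) (lam.im * d) 0 := hd.const_mul _
  have h3 : (fun x => lam.im * ψ x) = fun x => ∫ t in (-1:ℝ)..1, ψ t * sin (c * x * t) := by
    ext x; exact (eig_re_im hψ heig x).2
  rw [h3] at h2
  have h4 := h1.unique h2
  have h5 : (∫ s in (-1:ℝ)..1, ψ s * (cos (c * 0 * s) * (c * s))) = c * ∫ s in (-1:ℝ)..1, s * ψ s := by
    rw [← intervalIntegral.integral_const_mul]; congr 1; ext s; simp; ring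
  rw [h5] at h4
  rw [← abs_mul, h4, abs_mul]
  gcongr
  exact Complex.abs_im_le_norm lam

theorem quad_weights_pos
    (c : ℝ) (hc : c > 30)
    (n : ℕ) (hn : 0 < n)
    (ψn : ℝ → ℝ) (lamn : ℂ) (χn : ℝ)
    (hnd : ProlateDatum c n ψn lamn χn)
    (t : Fin n → ℝ) (ht_mono : StrictMono t)
    (ht_mem : ∀ j, t j ∈ Set.Ioo (-1:ℝ) 1)
    (ht_zero : ∀ j, ψn (t j) = 0)
    (hbig : (n : ℝ) > 2*c/π + 5 * Real.log c * Real.log (c/2)) :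
    ∀ j : Fin n, 0 < quadWeight ψn (t j) := by
  have hc0 : 0 < c := by linarith
  have an1 : ∀ x, AnalyticAt ℝ (deriv ψn) x := fun x => (hnd.analytic x).deriv
  have an2 : ∀ x, AnalyticAt ℝ (deriv (deriv ψn)) x := fun x => (an1 x).deriv
  have an3 : ∀ x, AnalyticAt ℝ (deriv (deriv (deriv ψn))) x := fun x => (an2 x).deriv
  have h : Prol c χn ψn (deriv ψn) (deriv (deriv ψn)) :=
    ⟨fun x => (hnd.analytic x).differentiableAt.hasDerivAt,
     fun x => (an1 x).differentiableAt.hasDerivAt, hnd.diff_eq⟩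
  have hpar := eig_parity h.c0 hnd.lam_ne_zero hnd.integral_eig
  have hsym : ∀ x, ψn x = 0 → ψn (-x) = 0 := by
    intro x hx
    have := hpar x
    rwa [hx, abs_zero, abs_eq_zero] at this
  have hall : ∀ x ∈ Ioo (-1:ℝ) 1, ψn x = 0 → ∃ j, t j = x := by
    intro x hx hx0
    have hfin : {x : ℝ | x ∈ Set.Ioo (-1:ℝ) 1 ∧ ψn x = 0}.Finite := by
      apply Set.finite_of_encard_eq_coe hnd.zeros_card
    have hsub : Set.range t ⊆ {x : ℝ | x ∈ Set.Ioo (-1:ℝ) 1 ∧ ψn x = 0} := by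
      rintro _ ⟨j, rfl⟩
      exact ⟨ht_mem j, ht_zero j⟩
    have hcard : (Set.range t).encard = n := by
      rw [← Set.image_univ, ht_mono.injective.encard_image, Set.encard_univ]
      simp
    have heq := (Set.finite_range t).eq_of_subset_of_encard_le hsub (by rw [hcard, hnd.zeros_card])
    have : x ∈ Set.range t := by rw [heq]; exact ⟨hx, hx0⟩
    exact this
  have hχ := chi_large h hc hn t ht_mono ht_mem ht_zero hall hsym hbig
  have l1 := ell_lower hc
  set l := Real.log (c / 2) with hl
  obtain ⟨e, hce, hχe⟩ : ∃ e, 4.5 * l ≤ c * e ∧ χn = c^2 * (1 + e)^2 := by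
    have hχ0 : 0 ≤ χn := le_trans (by positivity) hχ.le
    refine ⟨√χn / c - 1, ?_, ?_⟩
    · have h1 : c * (1 + 4.5 * l / c) ≤ √χn := by
        apply Real.le_sqrt_of_sq_le
        rw [mul_pow]; exact hχ.le
      have h2 : c * (1 + 4.5 * l / c) = c + 4.5 * l := by field_simp
      have h3 : c * (√χn / c - 1) = √χn - c := by field_simp
      rw [h3]; linarith
    · have h3 : c^2 * (1 + (√χn / c - 1))^2 = √χn ^ 2 := by field_simp; ring
      rw [h3, Real.sq_sqrt hχ0]
  have he0 : 0 < e := by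
    by_contra hcon
    push Not at hcon
    nlinarith
  have hχ1 : c^2 < χn := by
    rw [hχe]
    nlinarith [pow_pos hc0 2]
  have hbd : ∀ x ∈ Icc (0:ℝ) 1, |ψn x| ≤ |ψn 1| := by
    intro x hx
    have h1 := sonin h hχ1 hx
    apply sq_le_sq.1
    have hx2 : x^2 ≤ 1 := by nlinarith [hx.1, hx.2]
    have h2 : 0 < χn - c^2 * x^2 := by
      nlinarith [mul_le_mul_of_nonneg_left hx2 (sq_nonneg c)]
    have h3 : 0 ≤ (1 - x^2) * deriv ψn x ^ 2 / (χn - c^2 * x^2) :=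
      div_nonneg (mul_nonneg (by linarith) (sq_nonneg _)) h2.le
    linarith
  have hbd' : ∀ x ∈ Icc (-1:ℝ) 1, |ψn x| ≤ |ψn 1| := by
    intro x hx
    rcases le_total 0 x with h0 | h0
    · exact hbd x ⟨h0, hx.2⟩
    · rw [← hpar x]; exact hbd (-x) ⟨by linarith, by linarith [hx.1]⟩
  have hne : ψn 1 ≠ 0 := by
    intro h0
    have h1 : (∫ s in (-1:ℝ)..1, (ψn s)^2) = ∫ s in (-1:ℝ)..1, (0:ℝ) := by
      apply intervalIntegral.integral_congr
      intro s hs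
      rw [uIcc_of_le (by norm_num)] at hs
      have := hbd' s hs
      rw [h0, abs_zero] at this
      have : ψn s = 0 := abs_eq_zero.1 (le_antisymm this (abs_nonneg _))
      simp [this]
    rw [hnd.normalized] at h1
    simp at h1
  have hM : 0 < |ψn 1| := abs_pos.2 hne
  set M := |ψn 1| with hMdef
  have hd0 : |deriv ψn 0| ≤ c * (1 + e) * M := by
    have h1 := sonin h hχ1 (x := 0) ⟨le_refl _, zero_le_one⟩
    have hχ0 : 0 < χn := lt_trans (by positivity) hχ1
    have h2 : deriv ψn 0 ^ 2 / χn ≤ ψn 1 ^ 2 := by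
      have : (1 - (0:ℝ)^2) * deriv ψn 0 ^ 2 / (χn - c^2 * (0:ℝ)^2) = deriv ψn 0 ^ 2 / χn := by
        norm_num
      rw [this] at h1
      nlinarith [sq_nonneg (ψn 0)]
    rw [div_le_iff₀ hχ0] at h2
    apply abs_le_of_sq_le_sq _ (by positivity)
    calc deriv ψn 0 ^ 2 ≤ ψn 1 ^ 2 * χn := h2
      _ = (c * (1 + e) * M)^2 := by rw [hχe, ← sq_abs (ψn 1)]; ring
  have hgrow : exp (0.725 * (c * e)) * M ≤ |ψn (1 + 3 * e / 4)| := by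
    have h1 := grow (h.smul (ψn 1)⁻¹) (inv_mul_cancel₀ hne) hc he0 (by linarith) hχe
    have h2 := h1.trans (le_abs_self _)
    rw [abs_mul, abs_inv, inv_mul_eq_div, le_div_iff₀ hM] at h2
    exact h2
  have hlam : c^2 * (2 + e) * ‖lamn‖ < 1 := by
    have h1 := eig_bound hnd.integral_eig hbd' (1 + 3 * e / 4)
    have h2 := exp_big hc hce he0
    have hlp : 0 < ‖lamn‖ := norm_pos_iff.2 hnd.lam_ne_zero
    have h3 : ‖lamn‖ * (exp (0.725 * (c * e)) * M) ≤ 2 * M :=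
      (mul_le_mul_of_nonneg_left hgrow hlp.le).trans h1
    have h4 : ‖lamn‖ * exp (0.725 * (c * e)) ≤ 2 := by
      apply le_of_mul_le_mul_right _ hM
      linarith
    have h5 := mul_lt_mul_of_pos_left h2 hlp
    linarith
  have hI0 : |∫ s in (-1:ℝ)..1, ψn s| ≤ ‖lamn‖ * M := by
    rw [eig_I0 hnd.integral_eig]
    gcongr
    exact hbd 0 ⟨le_refl _, zero_le_one⟩
  have hI1 : |∫ s in (-1:ℝ)..1, s * ψn s| ≤ ‖lamn‖ * ((1 + e) * M) := by
    have h1 := eig_I1 h.c0 (h.d1 0) hnd.integral_eig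
    rw [abs_of_pos hc0] at h1
    have h2 := h1.trans (mul_le_mul_of_nonneg_left hd0 (norm_nonneg lamn))
    apply le_of_mul_le_mul_left _ hc0
    linarith
  intro j
  have hw := weight_identity c χn ψn _ _ _ h.d1 h.d2
    (fun x => (an2 x).differentiableAt.hasDerivAt)
    (continuous_iff_continuousAt.2 fun x => (an3 x).continuousAt) h.ode (t j) (ht_zero j)
  obtain ⟨tl, tr⟩ := ht_mem j
  set I0 := ∫ s in (-1:ℝ)..1, ψn s with hI0d
  set I1 := ∫ s in (-1:ℝ)..1, s * ψn s with hI1d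
  have herr : ‖∫ x in (t j)..1, c^2 * (ψn x * (I1 + x * I0))‖ ≤
      c^2 * (M * (‖lamn‖ * ((1 + e) * M) + ‖lamn‖ * M)) * |1 - t j| := by
    apply intervalIntegral.norm_integral_le_of_norm_le_const
    intro x hx
    rw [uIoc_of_le tr.le] at hx
    have hxm : x ∈ Icc (-1:ℝ) 1 := ⟨by linarith [hx.1], hx.2⟩
    have hx1 : |x| ≤ 1 := abs_le.2 hxm
    have hs : |I1 + x * I0| ≤ ‖lamn‖ * ((1 + e) * M) + ‖lamn‖ * M := by
      refine (abs_add_le _ _).trans (add_le_add hI1 ?_)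
      rw [abs_mul]
      exact (mul_le_of_le_one_left (abs_nonneg _) hx1).trans hI0
    rw [Real.norm_eq_abs, abs_mul, abs_mul, abs_of_nonneg (sq_nonneg c)]
    gcongr
    exact hbd' x hxm
  have habs : |1 - t j| ≤ 2 := by rw [abs_of_pos (by linarith)]; linarith
  have herr2 : ‖∫ x in (t j)..1, c^2 * (ψn x * (I1 + x * I0))‖ < 2 * M^2 := by
    have hnn : 0 ≤ c^2 * (M * (‖lamn‖ * ((1 + e) * M) + ‖lamn‖ * M)) := by positivity
    have h1 := herr.trans (mul_le_mul_of_nonneg_left habs hnn)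
    have h2 := mul_lt_mul_of_pos_right hlam (by positivity : 0 < 2 * M^2)
    have h3 : c^2 * (M * (‖lamn‖ * ((1 + e) * M) + ‖lamn‖ * M)) * 2 =
      c^2 * (2 + e) * ‖lamn‖ * (2 * M^2) := by ring
    linarith
  have hlow := (abs_lt.1 (by rwa [Real.norm_eq_abs] at herr2)).1
  have hMsq : M^2 = ψn 1 ^ 2 := sq_abs _
  have hpos : 0 < (1 - t j ^ 2) * (deriv ψn (t j) * ∫ s in (-1:ℝ)..1, ψn s / (s - t j)) := by
    rw [hw, ← hMsq]; linarith
  have hprod := (mul_pos_iff_of_pos_left (by nlinarith : 0 < 1 - t j ^ 2)).1 hpos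
  unfold quadWeight
  have hdne : deriv ψn (t j) ≠ 0 := left_ne_zero_of_mul hprod.ne'
  have : 1 / deriv ψn (t j) * (∫ s in (-1:ℝ)..1, ψn s / (s - t j)) =
      (deriv ψn (t j) * ∫ s in (-1:ℝ)..1, ψn s / (s - t j)) / deriv ψn (t j) ^ 2 := by
    field_simp
  rw [this]
  positivity
end

section
/- Let c > 0 be a real number and n ≥ 0 an integer. Then n·(n+1) < χ_n < n·(n+1) + c². -/
open Real MeasureTheory Set

/-- nonnegativity of the derivative at a left end zero -/
lemma deriv_nonneg_left_zero {u : ℝ → ℝ} {d a b : ℝ} (hab : a < b) (hu : HasDerivAt u d a)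
    (h0 : u a = 0) (hpos : ∀ x ∈ Ioo a b, 0 < u x) : 0 ≤ d := by
  have h := hu.hasDerivWithinAt (s := Ioi a)
  rw [hasDerivWithinAt_iff_tendsto_slope' (by simp)] at h
  refine ge_of_tendsto h ?_
  filter_upwards [Ioo_mem_nhdsGT hab] with x hx
  rw [slope_def_field, h0, sub_zero]
  exact div_nonneg (hpos x hx).le (by linarith [hx.1])

lemma deriv_nonpos_right_zero {u : ℝ → ℝ} {d a b : ℝ} (hab : a < b) (hu : HasDerivAt u d b)
    (h0 : u b = 0) (hpos : ∀ x ∈ Ioo a b, 0 < u x) : d ≤ 0 := by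
  have h := hu.hasDerivWithinAt (s := Iio b)
  rw [hasDerivWithinAt_iff_tendsto_slope' (by simp)] at h
  refine le_of_tendsto h ?_
  filter_upwards [Ioo_mem_nhdsLT hab] with x hx
  rw [slope_def_field, h0, sub_zero]
  exact div_nonpos_of_nonneg_of_nonpos (hpos x hx).le (by linarith [hx.2])

/-- The function u solves the Sturm-Liouville equation with weight 1 - x^2 and potential q. -/
def SturmSol (q : ℝ → ℝ) (u : ℝ → ℝ) : Prop :=
  ∃ u1 u2 : ℝ → ℝ, (∀ x, HasDerivAt u (u1 x) x) ∧ (∀ x, HasDerivAt u1 (u2 x) x) ∧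
    ∀ x, (1 - x^2) * u2 x - 2*x * u1 x + q x * u x = 0

lemma SturmSol.neg {q u : ℝ → ℝ} (h : SturmSol q u) : SturmSol q (fun x => - u x) := by
  obtain ⟨u1, u2, h1, h2, h3⟩ := h
  refine ⟨fun x => - u1 x, fun x => - u2 x, fun x => (h1 x).fun_neg, fun x => (h2 x).fun_neg,
    fun x => ?_⟩
  have := h3 x
  linear_combination - this

lemma SturmSol.continuous {q u : ℝ → ℝ} (h : SturmSol q u) : Continuous u := by
  obtain ⟨u1, u2, h1, h2, h3⟩ := h
  exact continuous_iff_continuousAt.2 fun x => (h1 x).continuousAt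

lemma sturm_pos {q r u v : ℝ → ℝ} {a b : ℝ} (hu : SturmSol q u) (hv : SturmSol r v)
    (ha : -1 ≤ a) (hab : a < b) (hb : b ≤ 1)
    (hqr : ∀ x ∈ Ioo (-1:ℝ) 1, x ≠ 0 → q x < r x)
    (hua : a = -1 ∨ u a = 0) (hub : b = 1 ∨ u b = 0)
    (hup : ∀ x ∈ Ioo a b, 0 < u x) (hvp : ∀ x ∈ Ioo a b, 0 < v x) : False := by
  have hvc := hv.continuous
  obtain ⟨u1, u2, hu1, hu2, hu3⟩ := hu
  obtain ⟨v1, v2, hv1, hv2, hv3⟩ := hv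
  have hvcl : ∀ x ∈ Icc a b, 0 ≤ v x := by
    intro x hx
    rw [← closure_Ioo hab.ne] at hx
    have : closure (Ioo a b) ⊆ {x | 0 ≤ v x} :=
      closure_minimal (fun y hy => (hvp y hy).le) (isClosed_le continuous_const hvc)
    exact this hx
  set W : ℝ → ℝ := fun x => (1 - x^2) * (u1 x * v x - u x * v1 x) with hW
  have hWd : ∀ x, HasDerivAt W ((r x - q x) * (u x * v x)) x := by
    intro x
    have h1 : HasDerivAt (fun x : ℝ => 1 - x^2) (-(2*x)) x := by
      simpa using ((hasDerivAt_pow 2 x).const_sub 1)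
    have h2 := h1.fun_mul (((hu2 x).fun_mul (hv1 x)).fun_sub ((hu1 x).fun_mul (hv2 x)))
    refine h2.congr_deriv ?_
    linear_combination v x * hu3 x - u x * hv3 x
  have hWa : 0 ≤ W a := by
    rcases hua with h | h
    · simp [hW, h]
    · have := deriv_nonneg_left_zero hab (hu1 a) h hup
      have h2 := hvcl a ⟨le_rfl, hab.le⟩
      have h3 : 0 ≤ 1 - a^2 := by nlinarith
      simp only [hW, h, zero_mul, sub_zero]
      positivity
  have hWb : W b ≤ 0 := by
    rcases hub with h | h
    · simp [hW, h]
    · have := deriv_nonpos_right_zero hab (hu1 b) h hup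
      have h2 := hvcl b ⟨hab.le, le_rfl⟩
      have h3 : 0 ≤ 1 - b^2 := by nlinarith
      simp only [hW, h, zero_mul, sub_zero]
      exact mul_nonpos_of_nonneg_of_nonpos h3 (mul_nonpos_of_nonpos_of_nonneg this h2)
  have hWc : Continuous W := continuous_iff_continuousAt.2 fun x => (hWd x).continuousAt
  -- strict monotonicity on pieces avoiding `0`
  have key : ∀ s t, a ≤ s → s < t → t ≤ b → (t ≤ 0 ∨ 0 ≤ s) → W s < W t := by
    intro s t has hst htb h0
    refine (strictMonoOn_of_deriv_pos (convex_Icc s t) hWc.continuousOn ?_)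
      (left_mem_Icc.2 hst.le) (right_mem_Icc.2 hst.le) hst
    intro x hx
    rw [interior_Icc] at hx
    rw [(hWd x).deriv]
    have hx' : x ∈ Ioo a b := ⟨by linarith [hx.1], by linarith [hx.2]⟩
    have hx0 : x ≠ 0 := by
      rintro rfl
      rcases h0 with h | h
      · linarith [hx.2]
      · linarith [hx.1]
    have := hqr x ⟨by linarith [hx'.1], by linarith [hx'.2]⟩ hx0
    exact mul_pos (by linarith) (mul_pos (hup x hx') (hvp x hx'))
  by_cases h1 : b ≤ 0
  · linarith [key a b le_rfl hab le_rfl (Or.inl h1)]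
  by_cases h2 : 0 ≤ a
  · linarith [key a b le_rfl hab le_rfl (Or.inr h2)]
  push Not at h1 h2
  linarith [key a 0 le_rfl h2 h1.le (Or.inl le_rfl), key 0 b h2.le h1 le_rfl (Or.inr le_rfl)]

lemma const_sign {u : ℝ → ℝ} {a b : ℝ} (hu : Continuous u) (h : ∀ x ∈ Ioo a b, u x ≠ 0) :
    (∀ x ∈ Ioo a b, 0 < u x) ∨ (∀ x ∈ Ioo a b, 0 < - u x) := by
  by_contra hcon
  push Not at hcon
  obtain ⟨⟨x, hx, hx1⟩, ⟨y, hy, hy1⟩⟩ := hcon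
  obtain ⟨z, hz, hz0⟩ := isPreconnected_Ioo.intermediate_value hx hy hu.continuousOn
    (show (0:ℝ) ∈ Icc (u x) (u y) from ⟨hx1, by linarith⟩)
  exact h z hz hz0

lemma sturm_gap {q r u v : ℝ → ℝ} {a b : ℝ} (hu : SturmSol q u) (hv : SturmSol r v)
    (ha : -1 ≤ a) (hab : a < b) (hb : b ≤ 1)
    (hqr : ∀ x ∈ Ioo (-1:ℝ) 1, x ≠ 0 → q x < r x)
    (hua : a = -1 ∨ u a = 0) (hub : b = 1 ∨ u b = 0)
    (hup : ∀ x ∈ Ioo a b, u x ≠ 0) : ∃ x ∈ Ioo a b, v x = 0 := by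
  by_contra hcon
  push Not at hcon
  have hua' : a = -1 ∨ - u a = 0 := by simpa using hua
  have hub' : b = 1 ∨ - u b = 0 := by simpa using hub
  rcases const_sign hu.continuous hup with h | h <;>
  rcases const_sign hv.continuous hcon with h' | h'
  · exact sturm_pos hu hv ha hab hb hqr hua hub h h'
  · exact sturm_pos hu hv.neg ha hab hb hqr hua hub h h'
  · exact sturm_pos hu.neg hv ha hab hb hqr hua' hub' h h'
  · exact sturm_pos hu.neg hv.neg ha hab hb hqr hua' hub' h h'

lemma sturm_count {q r u v : ℝ → ℝ} (hu : SturmSol q u) (hv : SturmSol r v)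
    (hqr : ∀ x ∈ Ioo (-1:ℝ) 1, x ≠ 0 → q x < r x) (Z T : Finset ℝ)
    (hZ : ∀ x, x ∈ Z ↔ x ∈ Ioo (-1:ℝ) 1 ∧ u x = 0)
    (hT : ∀ x, x ∈ T ↔ x ∈ Ioo (-1:ℝ) 1 ∧ v x = 0) : Z.card + 1 ≤ T.card := by
  classical
  have h1 : (1:ℝ) ∉ Z := by simp [hZ]
  have h2 : (-1:ℝ) ∉ insert 1 Z := by
    simp [hZ]
    norm_num
  have hcard : (insert (-1) (insert 1 Z)).card = Z.card + 2 := by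
    rw [Finset.card_insert_of_notMem h2, Finset.card_insert_of_notMem h1]
  have hmem : ∀ x ∈ insert (-1) (insert 1 Z), -1 ≤ x ∧ x ≤ 1 ∧
      (x = -1 ∨ x = 1 ∨ u x = 0) := by
    intro x hx
    simp only [Finset.mem_insert, hZ] at hx
    rcases hx with rfl | rfl | hx
    · norm_num
    · norm_num
    · exact ⟨hx.1.1.le, hx.1.2.le, Or.inr (Or.inr hx.2)⟩
  have := Finset.card_le_of_interleaved (s := insert (-1) (insert 1 Z)) (t := T) (by
    intro x hx y hy hxy hno
    obtain ⟨hx1, hx2, hx3⟩ := hmem x hx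
    obtain ⟨hy1, hy2, hy3⟩ := hmem y hy
    obtain ⟨z, hz, hz0⟩ := sturm_gap (a := x) (b := y) hu hv hx1 hxy hy2 hqr
      (by
        rcases hx3 with h | h | h
        · exact Or.inl h
        · linarith
        · exact Or.inr h)
      (by
        rcases hy3 with h | h | h
        · linarith
        · exact Or.inl h
        · exact Or.inr h)
      (by
        intro z hz h0
        refine hno z ?_ hz
        simp only [Finset.mem_insert, hZ]
        exact Or.inr (Or.inr ⟨⟨by linarith [hz.1], by linarith [hz.2]⟩, h0⟩))
    exact ⟨z, (hT z).2 ⟨⟨by linarith [hz.1], by linarith [hz.2]⟩, hz0⟩, hz.1, hz.2⟩)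
  omega

open Polynomial in
lemma rodrigues_ode (n k : ℕ) :
    (X^2 - 1) * derivative^[k+2] ((X^2 - 1)^n : ℝ[X])
      + C (2 * ((k:ℝ) + 1 - n)) * X * derivative^[k+1] ((X^2 - 1)^n : ℝ[X])
      + C (((k:ℝ)+1) * (k - 2*n)) * derivative^[k] ((X^2 - 1)^n : ℝ[X]) = 0 := by
  induction k with
  | zero =>
    have h : (X^2 - 1) * derivative ((X^2 - 1)^n : ℝ[X]) = C (2*(n:ℝ)) * X * (X^2-1)^n := by
      rw [derivative_pow]
      rcases n with _ | n
      · simp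
      · simp [derivative_pow]
        ring
    have h2 := congrArg derivative h
    simp [derivative_mul] at h2
    simp
    have hC : (C 2 : ℝ[X]) = 2 := rfl
    rw [hC] at h2
    try rw [hC]
    linear_combination h2
  | succ k ih =>
    have h2 := congrArg derivative ih
    simp only [derivative_add, derivative_mul, derivative_C, ← Function.iterate_succ_apply' derivative,
      derivative_sub, derivative_pow, derivative_X, derivative_one, derivative_zero] at h2
    simp at h2 ⊢
    have hC : (C 2 : ℝ[X]) = 2 := rfl
    rw [hC] at h2
    try rw [hC]
    linear_combination h2

open Polynomial in
lemma legendre_exists (n : ℕ) : ∃ P : ℝ[X], P ≠ 0 ∧ P.natDegree ≤ n ∧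
    SturmSol (fun _ => (n:ℝ) * (n+1)) (fun x => P.eval x) := by
  have hm : ((X^2 - 1)^n : ℝ[X]).Monic := by
    have : (X^2 - C 1 : ℝ[X]).Monic := monic_X_pow_sub_C 1 (by norm_num)
    simpa using this.pow n
  have hd : ((X^2 - 1)^n : ℝ[X]).natDegree = 2*n := by
    have : (X^2 - C 1 : ℝ[X]).natDegree = 2 := natDegree_X_pow_sub_C
    rw [natDegree_pow]
    simp at this
    rw [this, mul_comm]
  refine ⟨derivative^[n] ((X^2 - 1)^n), ?_, ?_, ?_⟩
  · intro h
    have := congrArg (fun p => coeff p n) h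
    simp only [coeff_iterate_derivative, coeff_zero] at this
    have h2 : ((X^2 - 1)^n : ℝ[X]).coeff (n+n) = 1 := by
      rw [← two_mul, ← hd]
      exact hm
    rw [h2] at this
    simp [Nat.descFactorial_eq_zero_iff_lt] at this
  · refine (natDegree_iterate_derivative _ n).trans ?_
    omega
  · refine ⟨fun x => (derivative^[n+1] ((X^2 - 1)^n : ℝ[X])).eval x,
      fun x => (derivative^[n+2] ((X^2 - 1)^n : ℝ[X])).eval x, ?_, ?_, ?_⟩
    · intro x
      rw [Function.iterate_succ_apply']
      exact Polynomial.hasDerivAt _ x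
    · intro x
      rw [Function.iterate_succ_apply' _ (n+1)]
      exact Polynomial.hasDerivAt _ x
    · intro x
      have := congrArg (eval x) (rodrigues_ode n n)
      simp only [eval_add, eval_mul, eval_sub, eval_pow, eval_X, eval_one, eval_C, eval_zero] at this
      linear_combination - this

open Polynomial in
lemma poly_zeros (P : ℝ[X]) (hP : P ≠ 0) : ∃ Z : Finset ℝ,
    (∀ x, x ∈ Z ↔ x ∈ Ioo (-1:ℝ) 1 ∧ P.eval x = 0) ∧ Z.card ≤ P.natDegree := by
  classical
  refine ⟨P.roots.toFinset.filter (fun x => x ∈ Ioo (-1:ℝ) 1), ?_, ?_⟩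
  · intro x
    simp [hP]
    tauto
  · exact (Finset.card_filter_le _ _).trans
      ((Multiset.toFinset_card_le _).trans (card_roots' P))

lemma legendre_count (n : ℕ) : ∃ (u : ℝ → ℝ) (Z : Finset ℝ),
    SturmSol (fun _ => (n:ℝ) * (n+1)) u ∧
    (∀ x, x ∈ Z ↔ x ∈ Ioo (-1:ℝ) 1 ∧ u x = 0) ∧ Z.card = n := by
  induction n with
  | zero =>
    obtain ⟨P, hP, hd, hS⟩ := legendre_exists 0
    obtain ⟨Z, hZ, hc⟩ := poly_zeros P hP
    exact ⟨_, Z, hS, hZ, by omega⟩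
  | succ n ih =>
    obtain ⟨u, Z', hu, hZ', hc'⟩ := ih
    obtain ⟨P, hP, hd, hS⟩ := legendre_exists (n+1)
    obtain ⟨Z, hZ, hc⟩ := poly_zeros P hP
    have := sturm_count hu hS (by
      intro x _ _
      push_cast
      nlinarith [(n.cast_nonneg : (0:ℝ) ≤ n)]) Z' Z hZ' hZ
    exact ⟨_, Z, hS, hZ, by omega⟩

theorem chi_crude_bounds
    (c : ℝ) (hc : 0 < c)
    (n : ℕ)
    (ψn : ℝ → ℝ) (lamn : ℂ) (χn : ℝ)
    (hnd : ProlateDatum c n ψn lamn χn) :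
    (n : ℝ) * ((n : ℝ) + 1) < χn ∧ χn < (n : ℝ) * ((n : ℝ) + 1) + c^2 := by
  have hψ : SturmSol (fun x => χn - c^2 * x^2) ψn :=
    ⟨deriv ψn, deriv (deriv ψn), fun x => (hnd.analytic x).differentiableAt.hasDerivAt,
      fun x => (hnd.analytic x).deriv.differentiableAt.hasDerivAt, hnd.diff_eq⟩
  have hfin : {x : ℝ | x ∈ Set.Ioo (-1:ℝ) 1 ∧ ψn x = 0}.Finite :=
    Set.finite_of_encard_eq_coe hnd.zeros_card
  have hT : ∀ x, x ∈ hfin.toFinset ↔ x ∈ Ioo (-1:ℝ) 1 ∧ ψn x = 0 := fun x => by simp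
  have hTc : hfin.toFinset.card = n := by
    have := hnd.zeros_card
    rw [hfin.encard_eq_coe_toFinset_card] at this
    exact_mod_cast this
  obtain ⟨u, Z, hu, hZ, hZc⟩ := legendre_count n
  constructor
  · by_contra! h
    have := sturm_count hψ hu (by
      intro x _ hx
      have : 0 < c^2 * x^2 := by positivity
      linarith) _ Z hT hZ
    omega
  · by_contra! h
    have := sturm_count hu hψ (by
      intro x hx _
      have h1 : x^2 < 1 := by nlinarith [hx.1, hx.2]
      have : c^2 * x^2 < c^2 * 1 := by gcongr
      linarith) Z _ hZ hT
    omega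
end

section
/- Let c > 0 be a real number and n ≥ 2 an integer, and suppose χ_n > c². Then n < (2/π)·∫_{0}^{1} √((χ_n − c²·t²)/(1 − t²)) dt < n + 3. -/
open Real MeasureTheory Set

structure Sys (χ k : ℝ) (Y P P' F s : ℝ → ℝ) : Prop where
  hk : 0 < k
  hχ : k < χ
  hY : ∀ τ, HasDerivAt Y (cos τ * P τ) τ
  hP : ∀ τ, HasDerivAt P (P' τ) τ
  hode : ∀ τ, cos τ * P' τ = 2 * sin τ * P τ - F τ ^ 2 * Y τ
  hFp : ∀ τ, 0 < F τ
  hFq : ∀ τ, F τ ^ 2 = χ - k * sin τ ^ 2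
  hF : ∀ τ, HasDerivAt F (-(k * sin τ * cos τ) / F τ) τ
  hs : ∀ τ, HasDerivAt s (F τ) τ

theorem Sys.neg {χ k : ℝ} {Y P P' F s : ℝ → ℝ} (h : Sys χ k Y P P' F s) :
    Sys χ k (fun τ => - Y τ) (fun τ => - P τ) (fun τ => - P' τ) F s where
  hk := h.hk
  hχ := h.hχ
  hY := fun τ => by
    exact (h.hY τ).neg.congr_deriv (by ring)
  hP := fun τ => (h.hP τ).neg
  hode := fun τ => by linear_combination - h.hode τ
  hFp := h.hFp
  hFq := h.hFq
  hF := h.hF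
  hs := h.hs

theorem Sys.s_mono {χ k : ℝ} {Y P P' F s : ℝ → ℝ} (h : Sys χ k Y P P' F s) : StrictMono s :=
  strictMono_of_deriv_pos (fun x => by rw [(h.hs x).deriv]; exact h.hFp x)

/-- The modified Wronskian. -/
noncomputable def MM (k σ₀ : ℝ) (Y P F s : ℝ → ℝ) (τ : ℝ) : ℝ :=
  - Y τ * sin (s τ - σ₀) + P τ * (sin τ * (F τ ^ 2 + k * cos τ ^ 2) / (2 * F τ ^ 4)) * sin (s τ - σ₀)
    - P τ * (cos τ / F τ) * cos (s τ - σ₀)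

theorem Sys.hasDerivAt_MM {χ k : ℝ} {Y P P' F s : ℝ → ℝ} (h : Sys χ k Y P P' F s) (σ₀ τ : ℝ)
    (hC : 0 < cos τ) :
    ∃ M', HasDerivAt (MM k σ₀ Y P F s) M' τ ∧
      M' + ((- sin τ / cos τ - k * sin τ * cos τ / F τ ^ 2) / 2) * MM k σ₀ Y P F s τ =
      (3 * (sin τ / cos τ) ^ 2 + 7 * (k * sin τ * cos τ / F τ ^ 2) ^ 2 + 2 + 2 * k / F τ ^ 2)
        / (4 * F τ ^ 2) * (cos τ * P τ * sin (s τ - σ₀)) := by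
  have hF0 := (h.hFp τ).ne'
  have hsn : HasDerivAt (fun τ => sin (s τ - σ₀)) (cos (s τ - σ₀) * F τ) τ :=
    ((h.hs τ).sub_const σ₀).sin
  have hcs : HasDerivAt (fun τ => cos (s τ - σ₀)) (- sin (s τ - σ₀) * F τ) τ :=
    ((h.hs τ).sub_const σ₀).cos
  have hS := Real.hasDerivAt_sin τ
  have hCo := Real.hasDerivAt_cos τ
  have hF := h.hF τ
  have d1 := ((h.hY τ).neg).mul hsn
  have d2 := ((h.hP τ).mul ((hS.mul ((hF.pow 2).add ((hCo.pow 2).const_mul k))).div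
    ((hF.pow 4).const_mul 2)
    (show 2 * F τ ^ 4 ≠ 0 by positivity))).mul hsn
  have d3 := ((h.hP τ).mul (hCo.div hF hF0)).mul hcs
  have d := (d1.add d2).sub d3
  refine ⟨_, d, ?_⟩
  have hP' : P' τ = (2 * sin τ * P τ - F τ ^ 2 * Y τ) / cos τ := by
    rw [eq_div_iff hC.ne', ← h.hode τ]; ring
  have hSC : sin τ ^ 2 = 1 - cos τ ^ 2 := by rw [Real.sin_sq]
  simp only [MM, hP', Pi.mul_apply, Pi.neg_apply, Pi.add_apply, Pi.div_apply, Pi.pow_apply]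
  generalize sin (s τ - σ₀) = a
  generalize cos (s τ - σ₀) = b
  generalize F τ = f at *
  generalize P τ = p at *
  generalize Y τ = y at *
  have hC0 := hC.ne'
  generalize cos τ = C at *
  generalize sin τ = S at *
  field_simp
  ring_nf
  have h4 : S ^ 4 = (1 - C ^ 2) ^ 2 := by rw [← hSC]; ring
  simp only [h4, hSC]
  ring

theorem Sys.core {χ k : ℝ} {Y P P' F s : ℝ → ℝ} (h : Sys χ k Y P P' F s) {a b : ℝ}
    (ha : -(π/2) ≤ a) (hab : a < b) (hb : b ≤ π/2) (hPa : cos a * P a = 0)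
    (hPb : cos b * P b = 0) (hpos : ∀ τ ∈ Ioo a b, 0 < P τ) : π < s b - s a := by
  by_contra hcon
  push Not at hcon
  have hcosnn : ∀ τ ∈ Icc a b, 0 ≤ cos τ := fun τ hτ =>
    cos_nonneg_of_neg_pi_div_two_le_of_le (by linarith [hτ.1]) (by linarith [hτ.2])
  have hcosp : ∀ τ ∈ Ioo a b, 0 < cos τ := fun τ hτ =>
    cos_pos_of_mem_Ioo ⟨by linarith [hτ.1], by linarith [hτ.2]⟩
  have hsm := h.s_mono
  have hFc : Continuous F := continuous_iff_continuousAt.2 fun x => (h.hF x).continuousAt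
  have hYc : Continuous Y := continuous_iff_continuousAt.2 fun x => (h.hY x).continuousAt
  have hPc : Continuous P := continuous_iff_continuousAt.2 fun x => (h.hP x).continuousAt
  have hsc : Continuous s := continuous_iff_continuousAt.2 fun x => (h.hs x).continuousAt
  have hF0 : ∀ x, F x ≠ 0 := fun x => (h.hFp x).ne'
  have hF04 : ∀ x, 2 * F x ^ 4 ≠ 0 := fun x => by have := h.hFp x; positivity
  let W : ℝ → ℝ := fun τ => √(cos τ * F τ) * MM k (s a) Y P F s τ
  have hWc : Continuous W := by
    simp only [W]
    unfold MM
    have e1 : Continuous fun τ => sin τ * (F τ ^ 2 + k * cos τ ^ 2) / (2 * F τ ^ 4) :=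
      Continuous.div (by fun_prop) (by fun_prop) hF04
    have e2 : Continuous fun τ => cos τ / F τ := Continuous.div (by fun_prop) hFc hF0
    fun_prop
  have hWd : ∀ τ ∈ Ioo a b, 0 < deriv W τ := by
    intro τ hτ
    have hC := hcosp τ hτ
    have hFp := h.hFp τ
    obtain ⟨M', hM', hM⟩ := h.hasDerivAt_MM (s a) τ hC
    have hw : 0 < cos τ * F τ := by positivity
    have hd1 := (((Real.hasDerivAt_cos τ).mul (h.hF τ)).sqrt hw.ne').mul hM'
    have hd : HasDerivAt W (√(cos τ * F τ) * (M' + ((- sin τ / cos τ - k * sin τ * cos τ / F τ ^ 2) / 2) * MM k (s a) Y P F s τ)) τ := by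
      refine hd1.congr_deriv ?_
      change (-sin τ * F τ + cos τ * (-(k * sin τ * cos τ) / F τ)) / (2 * √(cos τ * F τ)) * MM k (s a) Y P F s τ + √(cos τ * F τ) * M' = _
      have h1 : √(cos τ * F τ) ^ 2 = cos τ * F τ := Real.sq_sqrt hw.le
      have h2 : 0 < √(cos τ * F τ) := Real.sqrt_pos.2 hw
      generalize √(cos τ * F τ) = r at *
      generalize MM k (s a) Y P F s τ = m at *
      field_simp
      rw [h1]
      ring
    rw [hd.deriv, hM]
    have hsin : 0 < sin (s τ - s a) := sin_pos_of_pos_of_lt_pi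
      (by linarith [hsm hτ.1]) (by linarith [hsm hτ.2])
    have hPp := hpos τ hτ
    have hk := h.hk
    have h2 : 0 < √(cos τ * F τ) := Real.sqrt_pos.2 hw
    positivity
  have hmono : StrictMonoOn W (Icc a b) :=
    strictMonoOn_of_deriv_pos (convex_Icc a b) hWc.continuousOn (by rwa [interior_Icc])
  have hlt := hmono (left_mem_Icc.2 hab.le) (right_mem_Icc.2 hab.le) hab
  have hWa : W a = 0 := by
    simp only [W, MM, sub_self, sin_zero, cos_zero]
    rw [show - Y a * 0 + P a * (sin a * (F a ^ 2 + k * cos a ^ 2) / (2 * F a ^ 4)) * 0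
      - P a * (cos a / F a) * 1 = - (cos a * P a) / F a by ring, hPa]
    simp
  have hWb : W b ≤ 0 := by
    rcases (hcosnn b (right_mem_Icc.2 hab.le)).eq_or_lt with h0 | h0
    · simp [W, ← h0]
    · have hPb0 : P b = 0 := by
        rcases mul_eq_zero.1 hPb with h1 | h1
        · exact absurd h1 h0.ne'
        · exact h1
      have hYb : 0 ≤ Y b := by
        have hder : P' b ≤ 0 := by
          by_contra hcc
          push Not at hcc
          have hd := h.hP b
          have := (hasDerivAt_iff_tendsto_slope_left_right.1 hd).1
          have hev := this.eventually (lt_mem_nhds hcc)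
          have hev2 : ∀ᶠ x in nhdsWithin b (Iio b), x ∈ Ioo a b := Ioo_mem_nhdsLT hab
          obtain ⟨x, hx1, hx2⟩ := (hev.and hev2).exists
          have := hpos x hx2
          rw [slope_def_field, hPb0, div_pos_iff] at hx1
          rcases hx1 with h1 | h1
          · linarith [hx2.2]
          · linarith [hx2.2]
        have := h.hode b
        rw [hPb0] at this
        have hF2 : 0 < F b ^ 2 := by have := h.hFp b; positivity
        nlinarith
      have hsin : 0 ≤ sin (s b - s a) := sin_nonneg_of_nonneg_of_le_pi
        (by linarith [hsm hab]) hcon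
      simp only [W, MM, hPb0]
      have h2 : 0 ≤ √(cos b * F b) := Real.sqrt_nonneg _
      have := mul_nonneg h2 (mul_nonneg hYb hsin)
      linarith
  linarith

theorem Sys.lower {χ k : ℝ} {Y P P' F s : ℝ → ℝ} (h : Sys χ k Y P P' F s) {a b : ℝ}
    (ha : -(π/2) ≤ a) (hb : b ≤ π/2) (hPa : cos a * P a = 0)
    (hPb : cos b * P b = 0) (x : ℝ) (hx : x ∈ Ioo a b) (hPx : cos x * P x ≠ 0) :
    π < s b - s a := by
  have hPc : Continuous P := continuous_iff_continuousAt.2 fun x => (h.hP x).continuousAt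
  have hgc : Continuous (fun τ => cos τ * P τ) := by fun_prop
  have hcl : IsClosed {τ | cos τ * P τ = 0} := isClosed_eq hgc continuous_const
  have hA : IsCompact (Icc a x ∩ {τ | cos τ * P τ = 0}) := isCompact_Icc.inter_right hcl
  have hB : IsCompact (Icc x b ∩ {τ | cos τ * P τ = 0}) := isCompact_Icc.inter_right hcl
  obtain ⟨a', ⟨ha'1, ha'2⟩, ha'3⟩ := hA.exists_isGreatest ⟨a, ⟨le_rfl, hx.1.le⟩, hPa⟩
  obtain ⟨b', ⟨hb'1, hb'2⟩, hb'3⟩ := hB.exists_isLeast ⟨b, ⟨hx.2.le, le_rfl⟩, hPb⟩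
  have hax : a' < x := lt_of_le_of_ne ha'1.2 (fun e => hPx (e ▸ ha'2))
  have hxb : x < b' := lt_of_le_of_ne hb'1.1 (fun e => hPx (e ▸ hb'2))
  have hne : ∀ τ ∈ Ioo a' b', P τ ≠ 0 := by
    intro τ hτ h0
    rcases le_total τ x with h1 | h1
    · exact absurd (ha'3 ⟨⟨by linarith [ha'1.1, hτ.1], h1⟩, by simp [h0]⟩) (not_le.2 hτ.1)
    · exact absurd (hb'3 ⟨⟨h1, by linarith [hb'1.2, hτ.2]⟩, by simp [h0]⟩) (not_le.2 hτ.2)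
  have hmain : π < s b' - s a' := by
    have hsgn : (∀ τ ∈ Ioo a' b', 0 < P τ) ∨ (∀ τ ∈ Ioo a' b', P τ < 0) := by
      by_contra hcc
      push Not at hcc
      obtain ⟨⟨u, hu, hu'⟩, v, hv, hv'⟩ := hcc
      obtain ⟨z, hz, hz'⟩ := (isPreconnected_Ioo (a := a') (b := b')).intermediate_value hu hv
        hPc.continuousOn ⟨hu', hv'⟩
      exact hne z hz hz'
    rcases hsgn with hp | hp
    · exact h.core (by linarith [ha'1.1]) (hax.trans hxb) (by linarith [hb'1.2]) ha'2 hb'2 hp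
    · exact h.neg.core (by linarith [ha'1.1]) (hax.trans hxb) (by linarith [hb'1.2])
        (by simpa using ha'2) (by simpa using hb'2) (fun τ hτ => by linarith [hp τ hτ])
  have := h.s_mono.monotone ha'1.1
  have := h.s_mono.monotone hb'1.2
  linarith

theorem Sys.upper0 {χ k : ℝ} {Y P P' F s : ℝ → ℝ} (h : Sys χ k Y P P' F s) {a b : ℝ}
    (ha : -(π/2) < a) (hab : a < b) (hb : b < π/2) (hne : ∀ τ ∈ Icc a b, Y τ ≠ 0) :
    s b - s a ≤ π := by
  let R : ℝ → ℝ := fun τ =>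
    (cos τ * P τ / Y τ - (sin τ / cos τ + k * sin τ * cos τ / F τ ^ 2) / 2) / F τ
  have hcosp : ∀ τ ∈ Icc a b, 0 < cos τ := fun τ hτ =>
    cos_pos_of_mem_Ioo ⟨by linarith [hτ.1], by linarith [hτ.2]⟩
  have hRd : ∀ τ ∈ Icc a b, ∃ R', HasDerivAt R R' τ ∧ R' + F τ * (1 + R τ ^ 2) ≤ 0 := by
    intro τ hτ
    have hC := hcosp τ hτ
    have hY0 := hne τ hτ
    have hfp := h.hFp τ
    have hF0 := (h.hFp τ).ne'
    have hS := Real.hasDerivAt_sin τ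
    have hCo := Real.hasDerivAt_cos τ
    have hF := h.hF τ
    have hk := h.hk
    have d := (((hCo.mul (h.hP τ)).div (h.hY τ) hY0).sub
      (((hS.div hCo hC.ne').add (((hS.const_mul k).mul hCo).div (hF.pow 2)
        (pow_ne_zero 2 hF0))).div_const 2)).div hF hF0
    refine ⟨_, d, ?_⟩
    have hP' : P' τ = (2 * sin τ * P τ - F τ ^ 2 * Y τ) / cos τ := by
      rw [eq_div_iff hC.ne', ← h.hode τ]; ring
    have hSC : cos τ ^ 2 = 1 - sin τ ^ 2 := by rw [Real.cos_sq']
    simp only [R, hP', Pi.mul_apply, Pi.neg_apply, Pi.add_apply, Pi.sub_apply, Pi.div_apply, Pi.pow_apply]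
    generalize F τ = f at *
    generalize P τ = p at *
    generalize Y τ = y at *
    have hC0 := hC.ne'
    generalize cos τ = C at *
    generalize sin τ = S at *
    have key : (0:ℝ) ≤ (2 + (S / C) ^ 2 + 2 * k * C ^ 2 / f ^ 2 + 5 * (k * S * C / f ^ 2) ^ 2
        - 2 * (S / C) * (k * S * C / f ^ 2)) / (4 * f) := by
      apply div_nonneg _ (by positivity)
      have : 0 ≤ 2 * k * C ^ 2 / f ^ 2 := by positivity
      nlinarith [sq_nonneg (S / C - k * S * C / f ^ 2), sq_nonneg (k * S * C / f ^ 2)]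
    rw [← neg_nonneg]
    convert key using 1
    field_simp
    ring_nf
  choose! R' hR' hRle using hRd
  have hanti : AntitoneOn (fun τ => s τ + arctan (R τ)) (Icc a b) := by
    have hd : ∀ τ ∈ Icc a b, HasDerivAt (fun τ => s τ + arctan (R τ))
        (F τ + 1 / (1 + R τ ^ 2) * R' τ) τ := fun τ hτ => (h.hs τ).add (hR' τ hτ).arctan
    apply antitoneOn_of_deriv_nonpos (convex_Icc a b)
    · exact fun τ hτ => (hd τ hτ).continuousAt.continuousWithinAt
    · exact fun τ hτ => (hd τ (interior_subset hτ)).differentiableAt.differentiableWithinAt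
    · intro τ hτ
      have hτ' := interior_subset hτ
      rw [(hd τ hτ').deriv]
      have h1 := hRle τ hτ'
      have h2 : 0 < 1 + R τ ^ 2 := by positivity
      have : F τ + 1 / (1 + R τ ^ 2) * R' τ = (R' τ + F τ * (1 + R τ ^ 2)) / (1 + R τ ^ 2) := by
        field_simp; ring
      rw [this]
      exact div_nonpos_of_nonpos_of_nonneg h1 h2.le
  have := hanti (left_mem_Icc.2 hab.le) (right_mem_Icc.2 hab.le) hab.le
  simp only at this
  linarith [arctan_lt_pi_div_two (R a), neg_pi_div_two_lt_arctan (R b)]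

theorem Sys.upper {χ k : ℝ} {Y P P' F s : ℝ → ℝ} (h : Sys χ k Y P P' F s) {a b : ℝ}
    (ha : -(π/2) ≤ a) (hab : a < b) (hb : b ≤ π/2) (hne : ∀ τ ∈ Ioo a b, Y τ ≠ 0) :
    s b - s a ≤ π := by
  have hsc : Continuous s := continuous_iff_continuousAt.2 fun x => (h.hs x).continuousAt
  let m := (a + b) / 2
  have hm : a < m ∧ m < b := by constructor <;> simp only [m] <;> linarith
  have h1 : ∀ a' ∈ Ioo a m, s b - s a' ≤ π := by
    intro a' ha'
    have hlim : Filter.Tendsto (fun b' => s b' - s a') (nhdsWithin b (Iio b)) (nhds (s b - s a')) :=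
      ((hsc.tendsto b).sub_const _).mono_left nhdsWithin_le_nhds
    refine le_of_tendsto hlim ?_
    filter_upwards [Ioo_mem_nhdsLT hm.2] with b' hb'
    exact h.upper0 (by linarith [ha'.1]) (by linarith [ha'.2, hb'.1]) (by linarith [hb'.2])
      (fun τ hτ => hne τ ⟨by linarith [ha'.1, hτ.1], by linarith [hb'.2, hτ.2]⟩)
  have hlim : Filter.Tendsto (fun a' => s b - s a') (nhdsWithin a (Ioi a)) (nhds (s b - s a)) :=
      ((hsc.tendsto a).const_sub _).mono_left nhdsWithin_le_nhds
  refine le_of_tendsto hlim ?_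
  filter_upwards [Ioo_mem_nhdsGT hm.1] with a' ha'
  exact h1 a' ha'

theorem Sys.of_datum {c : ℝ} (hc : 0 < c) {n : ℕ} {ψ : ℝ → ℝ} {lam : ℂ} {χ : ℝ}
    (hnd : ProlateDatum c n ψ lam χ) (hχ : χ > c^2) :
    Sys χ (c^2) (fun τ => ψ (sin τ)) (fun τ => deriv ψ (sin τ))
      (fun τ => deriv (deriv ψ) (sin τ) * cos τ) (fun τ => √(χ - c^2 * sin τ ^ 2))
      (fun τ => ∫ x in (0:ℝ)..τ, √(χ - c^2 * sin x ^ 2)) := by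
  have hpos : ∀ τ : ℝ, 0 < χ - c^2 * sin τ ^ 2 := fun τ => by
    have h1 := Real.sin_sq_le_one τ
    have h2 : 0 < c^2 := by positivity
    nlinarith
  have hFc : Continuous (fun τ : ℝ => √(χ - c^2 * sin τ ^ 2)) := by fun_prop
  refine ⟨by positivity, hχ, ?_, ?_, ?_, ?_, ?_, ?_, ?_⟩
  · intro τ
    have h1 := (hnd.analytic (sin τ)).differentiableAt.hasDerivAt
    exact (h1.comp τ (Real.hasDerivAt_sin τ)).congr_deriv (by ring)
  · intro τ
    have h1 := (hnd.analytic (sin τ)).deriv.differentiableAt.hasDerivAt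
    exact (h1.comp τ (Real.hasDerivAt_sin τ))
  · intro τ
    have h1 := hnd.diff_eq (sin τ)
    rw [Real.sq_sqrt (hpos τ).le]
    linear_combination h1 + deriv (deriv ψ) (sin τ) * (Real.sin_sq_add_cos_sq τ)
  · exact fun τ => Real.sqrt_pos.2 (hpos τ)
  · exact fun τ => Real.sq_sqrt (hpos τ).le
  · intro τ
    have h1 := (((((Real.hasDerivAt_sin τ).pow 2).const_mul (c^2)).const_sub χ).sqrt (hpos τ).ne')
    refine h1.congr_deriv ?_
    have := Real.sqrt_pos.2 (hpos τ)
    simp only [Pi.pow_apply]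
    field_simp
    push_cast
    ring
  · intro τ
    exact intervalIntegral.integral_hasDerivAt_right (hFc.intervalIntegrable _ _)
      hFc.stronglyMeasurable.stronglyMeasurableAtFilter hFc.continuousAt

theorem integral_change {c χ : ℝ} (hχ : χ > c^2) :
    ∫ t in (0:ℝ)..1, √((χ - c^2 * t^2) / (1 - t^2)) =
      ∫ x in (0:ℝ)..(π/2), √(χ - c^2 * sin x ^ 2) := by
  have hFc : Continuous (fun τ : ℝ => √(χ - c^2 * sin τ ^ 2)) := by fun_prop
  let s : ℝ → ℝ := fun τ => ∫ x in (0:ℝ)..τ, √(χ - c^2 * sin x ^ 2)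
  have hs : ∀ τ, HasDerivAt s (√(χ - c^2 * sin τ ^ 2)) τ := fun τ =>
    intervalIntegral.integral_hasDerivAt_right (hFc.intervalIntegrable _ _)
      hFc.stronglyMeasurable.stronglyMeasurableAtFilter hFc.continuousAt
  have hsc : Continuous s := continuous_iff_continuousAt.2 fun x => (hs x).continuousAt
  have hd : ∀ x ∈ Ioo (0:ℝ) 1, HasDerivAt (fun x => s (arcsin x))
      (√((χ - c^2 * x^2) / (1 - x^2))) x := by
    intro x hx
    have h1 := (hs (arcsin x)).comp x (Real.hasDerivAt_arcsin (by linarith [hx.1]) hx.2.ne)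
    refine h1.congr_deriv ?_
    rw [Real.sin_arcsin (by linarith [hx.1]) hx.2.le, Real.sqrt_div' _ (by nlinarith [hx.1, hx.2])]
    ring
  have hcont : ContinuousOn (fun x => s (arcsin x)) (Icc 0 1) :=
    (hsc.comp Real.continuous_arcsin).continuousOn
  have hint := intervalIntegral.integrableOn_deriv_of_nonneg hcont hd (fun x hx => Real.sqrt_nonneg _)
  have h2 := intervalIntegral.integral_eq_sub_of_hasDerivAt_of_le zero_le_one hcont hd
    ((intervalIntegrable_iff_integrableOn_Ioc_of_le zero_le_one).2 hint)
  rw [h2]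
  simp [s]

theorem count_zeros_s10 {χ k : ℝ} {Y P P' F s : ℝ → ℝ} (h : Sys χ k Y P P' F s) (Z : Finset ℝ)
    (hZ : ∀ x, x ∈ Z ↔ x ∈ Ioo (-(π/2)) (π/2) ∧ Y x = 0) (hn : 1 ≤ Z.card) :
    (Z.card : ℝ) * π < s (π/2) - s (-(π/2)) ∧ s (π/2) - s (-(π/2)) ≤ (Z.card + 1) * π := by
  set n := Z.card with hnn
  let e := Z.orderEmbOfFin hnn.symm
  have he : ∀ i, e i ∈ Ioo (-(π/2)) (π/2) ∧ Y (e i) = 0 := fun i =>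
    (hZ _).1 (Z.orderEmbOfFin_mem hnn.symm i)
  have hsurj : ∀ x ∈ Ioo (-(π/2)) (π/2), Y x = 0 → ∃ i, e i = x := by
    intro x hx hx0
    have : x ∈ (Z : Set ℝ) := (hZ x).2 ⟨hx, hx0⟩
    rw [← Z.range_orderEmbOfFin hnn.symm] at this
    exact this
  have hYc : Continuous Y := continuous_iff_continuousAt.2 fun x => (h.hY x).continuousAt
  -- nonvanishing of the derivative somewhere to the right of a zero
  have hnz : ∀ (x b : ℝ), -(π/2) < x → x < b → b ≤ π/2 → Y x = 0 →
      ∃ y ∈ Ioo x b, cos y * P y ≠ 0 := by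
    intro x b hx hxb hb hx0
    by_contra hcc
    push Not at hcc
    have hzero : ∀ y ∈ Ioo x b, Y y = 0 := by
      intro y hy
      have hmvt := exists_hasDerivAt_eq_slope Y (fun τ => cos τ * P τ) hy.1 hYc.continuousOn
        (fun z _ => h.hY z)
      obtain ⟨z, hz, hz'⟩ := hmvt
      rw [hcc z ⟨hz.1, hz.2.trans hy.2⟩, hx0] at hz'
      have : y - x ≠ 0 := by linarith [hy.1]
      rw [eq_comm, div_eq_zero_iff] at hz'
      rcases hz' with h1 | h1
      · linarith
      · exact absurd h1 this
    have hsub : Ioo x b ⊆ (Z : Set ℝ) := fun y hy =>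
      (hZ y).2 ⟨⟨by linarith [hy.1], by linarith [hy.2]⟩, hzero y hy⟩
    exact (Set.Ioo_infinite hxb) (Z.finite_toSet.subset hsub)
  have hpi := Real.pi_pos
  constructor
  · have key : ∀ m : ℕ, ∀ hm : m < n, ∃ y, -(π/2) ≤ y ∧ y < e ⟨m, hm⟩ ∧ cos y * P y = 0 ∧
        (m : ℝ) * π ≤ s y - s (-(π/2)) := by
      intro m
      induction m with
      | zero =>
        intro hm
        exact ⟨-(π/2), le_rfl, (he _).1.1, by simp, by simp⟩
      | succ m ih =>
        intro hm
        obtain ⟨y, hy1, hy2, hy3, hy4⟩ := ih (by omega)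
        have hlt : e ⟨m, by omega⟩ < e ⟨m+1, hm⟩ := e.strictMono (by simp [Fin.lt_def])
        obtain ⟨z, hz, hz'⟩ := exists_hasDerivAt_eq_zero hlt hYc.continuousOn
          (by rw [(he _).2, (he _).2]) (fun x _ => h.hY x)
        have hz2 : z ≤ π/2 := by linarith [hz.2, (he ⟨m+1, hm⟩).1.2]
        obtain ⟨x, hx, hx'⟩ := hnz _ z (he ⟨m, by omega⟩).1.1 hz.1 hz2 (he _).2
        have := h.lower hy1 hz2 hy3 hz' x ⟨hy2.trans hx.1, hx.2⟩ hx'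
        refine ⟨z, by linarith [hz.1], hz.2, hz', ?_⟩
        push_cast
        linarith
    obtain ⟨y, hy1, hy2, hy3, hy4⟩ := key (n-1) (by omega)
    obtain ⟨x, hx, hx'⟩ := hnz _ (π/2) (he ⟨n-1, by omega⟩).1.1 (he _).1.2 le_rfl (he _).2
    have := h.lower hy1 le_rfl hy3 (by simp) x ⟨hy2.trans hx.1, hx.2⟩ hx'
    have hc : ((n - 1 : ℕ) : ℝ) = n - 1 := by push_cast [hn]; ring
    rw [hc] at hy4
    linarith
  · have key : ∀ m : ℕ, ∀ hm : m < n, s (e ⟨m, hm⟩) - s (-(π/2)) ≤ (m + 1) * π := by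
      intro m
      induction m with
      | zero =>
        intro hm
        have := h.upper le_rfl (he ⟨0, hm⟩).1.1 (he ⟨0, hm⟩).1.2.le (by
          intro τ hτ h0
          obtain ⟨i, rfl⟩ := hsurj τ ⟨hτ.1, hτ.2.trans (he _).1.2⟩ h0
          have := e.lt_iff_lt.1 hτ.2
          simp [Fin.lt_def] at this)
        simpa using this
      | succ m ih =>
        intro hm
        have h1 := ih (by omega)
        have hlt : e ⟨m, by omega⟩ < e ⟨m+1, hm⟩ := e.strictMono (by simp [Fin.lt_def])
        have := h.upper (he ⟨m, by omega⟩).1.1.le hlt (he ⟨m+1, hm⟩).1.2.le (by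
          intro τ hτ h0
          obtain ⟨i, rfl⟩ := hsurj τ ⟨(he _).1.1.trans hτ.1, hτ.2.trans (he _).1.2⟩ h0
          have h1 := e.lt_iff_lt.1 hτ.1
          have h2 := e.lt_iff_lt.1 hτ.2
          simp only [Fin.lt_def] at h1 h2
          omega)
        push_cast
        linarith
    have h1 := key (n-1) (by omega)
    have := h.upper (he ⟨n-1, by omega⟩).1.1.le (he _).1.2 le_rfl (by
      intro τ hτ h0
      obtain ⟨i, rfl⟩ := hsurj τ ⟨(he _).1.1.trans hτ.1, hτ.2⟩ h0
      have h1 := e.lt_iff_lt.1 hτ.1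
      simp only [Fin.lt_def] at h1
      omega)
    have hc : ((n - 1 : ℕ) : ℝ) = n - 1 := by push_cast [hn]; ring
    rw [hc] at h1
    linarith

theorem n_khi_integral_bounds
    (c : ℝ) (hc : 0 < c)
    (n : ℕ) (hn : 2 ≤ n)
    (ψn : ℝ → ℝ) (lamn : ℂ) (χn : ℝ)
    (hnd : ProlateDatum c n ψn lamn χn)
    (hχ : χn > c^2) :
    (n : ℝ) < (2/π) * ∫ t in (0:ℝ)..1, Real.sqrt ((χn - c^2 * t^2) / (1 - t^2)) ∧
    (2/π) * (∫ t in (0:ℝ)..1, Real.sqrt ((χn - c^2 * t^2) / (1 - t^2))) < (n : ℝ) + 3 := by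
  have hsys := Sys.of_datum hc hnd hχ
  have hz := hnd.zeros_card
  have hfin : {x : ℝ | x ∈ Set.Ioo (-1:ℝ) 1 ∧ ψn x = 0}.Finite := by
    apply Set.finite_of_encard_eq_coe hz
  have hcard : hfin.toFinset.card = n := by
    rw [hfin.encard_eq_coe_toFinset_card] at hz
    exact_mod_cast hz
  let Z : Finset ℝ := hfin.toFinset.image arcsin
  have hZc : Z.card = n := by
    rw [← hcard]
    apply Finset.card_image_of_injOn
    intro x hx y hy hxy
    simp only [Finite.coe_toFinset, mem_setOf_eq] at hx hy
    exact Real.injOn_arcsin (Ioo_subset_Icc_self hx.1) (Ioo_subset_Icc_self hy.1) hxy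
  have hZ : ∀ x, x ∈ Z ↔ x ∈ Ioo (-(π/2)) (π/2) ∧ ψn (sin x) = 0 := by
    intro x
    simp only [Z, Finset.mem_image, Finite.mem_toFinset, mem_setOf_eq]
    constructor
    · rintro ⟨y, ⟨hy, hy0⟩, rfl⟩
      refine ⟨⟨Real.neg_pi_div_two_lt_arcsin.2 hy.1, Real.arcsin_lt_pi_div_two.2 hy.2⟩, ?_⟩
      rw [Real.sin_arcsin hy.1.le hy.2.le]
      exact hy0
    · rintro ⟨hx, hx0⟩
      have h1 : arcsin (sin x) = x := Real.arcsin_sin hx.1.le hx.2.le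
      refine ⟨sin x, ⟨⟨?_, ?_⟩, hx0⟩, h1⟩
      · exact Real.neg_pi_div_two_lt_arcsin.1 (by rw [h1]; exact hx.1)
      · exact Real.arcsin_lt_pi_div_two.1 (by rw [h1]; exact hx.2)
  have hmain := count_zeros_s10 hsys Z hZ (by omega)
  rw [hZc] at hmain
  have hneg : ∫ x in (0:ℝ)..(-(π/2)), √(χn - c^2 * sin x ^ 2) =
      - ∫ x in (0:ℝ)..(π/2), √(χn - c^2 * sin x ^ 2) := by
    have h1 := intervalIntegral.integral_comp_neg (a := 0) (b := π/2)
      (fun x : ℝ => √(χn - c^2 * sin x ^ 2))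
    simp only [Real.sin_neg, neg_sq, neg_zero] at h1
    rw [intervalIntegral.integral_symm, ← h1]
  rw [integral_change hχ]
  rw [hneg] at hmain
  have hpi := Real.pi_pos
  generalize (∫ x in (0:ℝ)..(π/2), √(χn - c^2 * sin x ^ 2)) = I at *
  obtain ⟨h1, h2⟩ := hmain
  rw [div_mul_eq_mul_div, lt_div_iff₀ hpi, div_lt_iff₀ hpi]
  constructor <;> linarith
end
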